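/- arXiv:2109.02010 — 4 statements merged into one kernel-verified Lean document; each statement's English description precedes it below -/
import Mathlib

section
/- If x is a harmonic bounded operator on F and i ∈ Θ, then P_ω(r_i x) = r_i x + ω i • (p_Ω x l_i), and P_ω(P_ω(r_i x)) = P_ω(r_i x). Consequently P_ω^n(r_i x) = r_i x + ω i • (p_Ω x l_i) for all n ≥ 1, so the sequence (P_ω^n(r_i x)) converges in SOT to r_i x + ω i • (p_Ω x l_i). -/
open Filter Topology

noncomputable section

/-- The full Fock space over a Hilbert space with orthonormal basis indexed by `Θ`,
realized as `ℓ²(List Θ)`. -/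
abbrev Fock (Θ : Type*) : Type _ := lp (fun _ : List Θ => ℂ) 2

/-- The canonical orthonormal basis vector `e_I` of the Fock space, indexed by a word
`I : List Θ`.  The vacuum vector is `Ω = fockBasis []`. -/
noncomputable def fockBasis {Θ : Type*} [DecidableEq Θ] (I : List Θ) : Fock Θ :=
  lp.single 2 I 1

/-- For a word `I = [i₁, …, i_k]`, `wordOp r I = r i₁ ∘L ⋯ ∘L r i_k`, the identity for the
empty word.  Applied to the right (resp. left) creation operators, this gives `r_I`
(resp. `l_I`). -/
noncomputable def wordOp {Θ : Type*} (r : Θ → Fock Θ →L[ℂ] Fock Θ) :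
    List Θ → (Fock Θ →L[ℂ] Fock Θ)
  | [] => 1
  | i :: I => r i ∘L wordOp r I

theorem fock_inner_basis {Θ : Type*} [DecidableEq Θ] (I : List Θ) (v : Fock Θ) :
    (inner ℂ (fockBasis I) v : ℂ) = v I := by
  unfold fockBasis
  rw [lp.inner_single_left]
  simp

theorem fock_basis_apply {Θ : Type*} [DecidableEq Θ] (I J : List Θ) :
    (fockBasis I : Fock Θ) J = if J = I then 1 else 0 := by
  unfold fockBasis
  rw [lp.single_apply]
  by_cases h : J = I
  · subst h; simp
  · simp [h]

theorem fock_ext {Θ : Type*} [DecidableEq Θ] (A B : Fock Θ →L[ℂ] Fock Θ)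
    (h : ∀ I, A (fockBasis I) = B (fockBasis I)) : A = B := by
  ext1 v
  have hv := lp.hasSum_single (p := 2) (by norm_num) v
  have e : ∀ I : List Θ, lp.single 2 I (v I) = v I • (fockBasis I : Fock Θ) := by
    intro I
    unfold fockBasis
    rw [← lp.single_smul]
    simp
  have h1 := hv.mapL A
  have h2 := hv.mapL B
  simp only [e, map_smul, h] at h1 h2
  exact h1.unique h2

theorem fock_adj_apply {Θ : Type*} [DecidableEq Θ] (L : Fock Θ →L[ℂ] Fock Θ) (j : Θ)
    (hl : ∀ I : List Θ, L (fockBasis I) = fockBasis (j :: I)) (w : Fock Θ) (J : List Θ) :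
    (ContinuousLinearMap.adjoint L w) J = w (j :: J) := by
  rw [← fock_inner_basis, ContinuousLinearMap.adjoint_inner_right, hl, fock_inner_basis]

theorem fock_norm_le {Θ : Type*} [DecidableEq Θ] (L : Fock Θ →L[ℂ] Fock Θ) (j : Θ)
    (hl : ∀ I : List Θ, L (fockBasis I) = fockBasis (j :: I)) : ‖L‖ ≤ 1 := by
  have h : ContinuousLinearMap.adjoint L ∘L L = 1 := by
    apply fock_ext
    intro I
    ext J
    rw [ContinuousLinearMap.comp_apply, fock_adj_apply L j hl, hl, fock_basis_apply]
    simp [fock_basis_apply]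
  have h2 : ‖L‖ * ‖L‖ ≤ 1 := by
    rw [← ContinuousLinearMap.norm_adjoint_comp_self, h]
    exact ContinuousLinearMap.norm_id_le
  nlinarith [norm_nonneg L]

/-- If `x` is harmonic and `i ∈ Θ`, then
`P_ω (rᵢ x) = rᵢ x + ωᵢ • (p_Ω x lᵢ)`, `P_ω² (rᵢ x) = P_ω (rᵢ x)`, hence
`P_ω^n (rᵢ x) = rᵢ x + ωᵢ • (p_Ω x lᵢ)` for all `n ≥ 1`, and `(P_ω^n (rᵢ x))` converges in
SOT to `rᵢ x + ωᵢ • (p_Ω x lᵢ)`. -/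
theorem statement5 {Θ : Type*} [Countable Θ] [Nonempty Θ] [DecidableEq Θ]
    (l r : Θ → Fock Θ →L[ℂ] Fock Θ)
    (hl : ∀ (i : Θ) (I : List Θ), l i (fockBasis I) = fockBasis (i :: I))
    (hr : ∀ (i : Θ) (I : List Θ), r i (fockBasis I) = fockBasis (I ++ [i]))
    (pΩ : Fock Θ →L[ℂ] Fock Θ)
    (hpΩ : ∀ v : Fock Θ,
      pΩ v = (inner ℂ (fockBasis ([] : List Θ)) v : ℂ) • fockBasis ([] : List Θ))
    (ω : Θ → ℝ) (hω : ∀ i, 0 < ω i) (hω1 : ∑' i, ω i = 1)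
    (P : (Fock Θ →L[ℂ] Fock Θ) → (Fock Θ →L[ℂ] Fock Θ))
    (hP : ∀ (x : Fock Θ →L[ℂ] Fock Θ) (v : Fock Θ),
      P x v = ∑' i, (ω i : ℂ) • ((ContinuousLinearMap.adjoint (l i) ∘L x ∘L l i) v))
    (x : Fock Θ →L[ℂ] Fock Θ) (hx : P x = x) (i : Θ) :
    P (r i ∘L x) = r i ∘L x + (ω i : ℂ) • (pΩ ∘L x ∘L l i) ∧
    P (P (r i ∘L x)) = P (r i ∘L x) ∧
    (∀ n : ℕ, 1 ≤ n → P^[n] (r i ∘L x) = r i ∘L x + (ω i : ℂ) • (pΩ ∘L x ∘L l i)) ∧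
    (∀ v : Fock Θ, Tendsto (fun n : ℕ => (P^[n] (r i ∘L x)) v) atTop
      (𝓝 ((r i ∘L x + (ω i : ℂ) • (pΩ ∘L x ∘L l i)) v))) := by
  have hsω : Summable ω := by
    by_contra hn
    rw [tsum_eq_zero_of_not_summable hn] at hω1
    exact zero_ne_one hω1
  have hnorm : ∀ j, ‖l j‖ ≤ 1 := fun j => fock_norm_le (l j) j (hl j)
  have hsum : ∀ v, Summable fun j =>
      (ω j : ℂ) • ((ContinuousLinearMap.adjoint (l j) ∘L x ∘L l j) v) := by
    intro v
    refine Summable.of_norm_bounded (g := fun j => ω j * (‖x‖ * ‖v‖)) (hsω.mul_right _) ?_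
    intro j
    rw [norm_smul, Complex.norm_real, Real.norm_of_nonneg (hω j).le]
    refine mul_le_mul_of_nonneg_left ?_ (hω j).le
    have h1 : ‖l j v‖ ≤ ‖v‖ := by
      simpa using (l j).le_of_opNorm_le (hnorm j) v
    have h2 : ‖ContinuousLinearMap.adjoint (l j) (x (l j v))‖ ≤ ‖x (l j v)‖ := by
      simpa using (ContinuousLinearMap.adjoint (l j)).le_of_opNorm_le
        (c := 1) (by simpa using hnorm j) (x (l j v))
    exact h2.trans ((x.le_opNorm _).trans (by gcongr))
  have hvac : ∀ j, ContinuousLinearMap.adjoint (l j) (fockBasis []) = 0 := by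
    intro j
    ext J
    rw [fock_adj_apply (l j) j (hl j), fock_basis_apply]
    simp
  have hcomm : ∀ j, ContinuousLinearMap.adjoint (l j) ∘L r i
      = r i ∘L ContinuousLinearMap.adjoint (l j) + (if j = i then pΩ else 0) := by
    intro j
    apply fock_ext
    intro I
    have hcons : ∀ (k : Θ) (K : List Θ), ContinuousLinearMap.adjoint (l j) (fockBasis (k :: K))
        = if j = k then fockBasis K else 0 := by
      intro k K
      ext J
      rw [fock_adj_apply (l j) j (hl j), fock_basis_apply]
      by_cases h : j = k
      · simp [h, fock_basis_apply]
      · simp [h]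
    rcases I with _ | ⟨k, K⟩
    · by_cases h : j = i
      · subst h
        have hp : pΩ (fockBasis []) = fockBasis [] := by
          rw [hpΩ, fock_inner_basis, fock_basis_apply]; simp
        simp [hr, hvac, hcons, hp]
      · simp [hr, hvac, hcons, h]
    · have hp : pΩ (fockBasis (k :: K)) = 0 := by
        rw [hpΩ, fock_inner_basis, fock_basis_apply]; simp
      have hp2 : (if j = i then pΩ else 0) (fockBasis (k :: K)) = 0 := by
        split_ifs
        · exact hp
        · rfl
      rw [add_apply, hp2, add_zero, ContinuousLinearMap.comp_apply,
        ContinuousLinearMap.comp_apply, hr, List.cons_append, hcons, hcons]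
      split_ifs
      · rw [hr]
      · simp
  have key : P (r i ∘L x) = r i ∘L x + (ω i : ℂ) • (pΩ ∘L x ∘L l i) := by
    ext1 v
    rw [hP]
    have e : ∀ j, (ω j : ℂ) • ((ContinuousLinearMap.adjoint (l j) ∘L (r i ∘L x) ∘L l j) v)
        = r i ((ω j : ℂ) • ((ContinuousLinearMap.adjoint (l j) ∘L x ∘L l j) v))
          + (if j = i then (ω i : ℂ) • pΩ (x (l i v)) else 0) := by
      intro j
      have := congrArg (fun T => T (x (l j v))) (hcomm j)
      simp only [ContinuousLinearMap.comp_apply, add_apply] at this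
      simp only [ContinuousLinearMap.comp_apply]
      rw [this, smul_add, map_smul]
      by_cases h : j = i
      · subst h; simp
      · simp [h]
    have h1 := (hsum v).hasSum.mapL (r i)
    rw [← hP, hx] at h1
    have h2 := hasSum_ite_eq i ((ω i : ℂ) • pΩ (x (l i v)))
    simp only [e]
    exact (h1.add h2).tsum_eq
  have key2 : P (P (r i ∘L x)) = P (r i ∘L x) := by
    conv_lhs => rw [key]
    ext1 v
    rw [hP, hP]
    refine tsum_congr fun j => ?_
    have h0 : ContinuousLinearMap.adjoint (l j)
        (((ω i : ℂ) • (pΩ ∘L x ∘L l i)) (l j v)) = 0 := by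
      change ContinuousLinearMap.adjoint (l j) ((ω i : ℂ) • pΩ (x (l i (l j v)))) = 0
      rw [hpΩ, map_smul, map_smul, hvac, smul_zero, smul_zero]
    simp only [ContinuousLinearMap.comp_apply, add_apply, map_add, h0, add_zero]
  have key3 : ∀ n : ℕ, 1 ≤ n →
      P^[n] (r i ∘L x) = r i ∘L x + (ω i : ℂ) • (pΩ ∘L x ∘L l i) := by
    intro n hn
    induction n, hn using Nat.le_induction with
    | base => simpa using key
    | succ n hn ih => rw [Function.iterate_succ_apply', ih, ← key, key2]
  refine ⟨key, key2, key3, fun v => ?_⟩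
  refine tendsto_const_nhds.congr' ?_
  filter_upwards [eventually_ge_atTop 1] with n hn
  rw [key3 n hn]
end
end

section
/- Let x be a positive bounded operator on F (self-adjoint with ⟪x v, v⟫ ≥ 0 for all v) which is harmonic. If ⟪x Ω, Ω⟫ = 0, then x = 0. -/
open Filter Topology
open scoped ComplexOrder

noncomputable section

theorem pos_ker {E : Type*} [NormedAddCommGroup E] [InnerProductSpace ℂ E] [CompleteSpace E]
    (x : E →L[ℂ] E) (hsa : ContinuousLinearMap.adjoint x = x)
    (hpos : ∀ v : E, 0 ≤ (inner ℂ (x v) v : ℂ).re) (v : E)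
    (h : (inner ℂ (x v) v : ℂ).re = 0) : x v = 0 := by
  have key : ∀ t : ℝ, 0 ≤ (inner ℂ (x (x v)) (x v) : ℂ).re * (t * t) + (-2 * ‖x v‖ ^ 2) * t + 0 := by
    intro t
    have h1 := hpos (v - (t : ℂ) • x v)
    have h2 : (inner ℂ (x (x v)) v : ℂ) = inner ℂ (x v) (x v) := by
      conv_lhs => rw [← hsa]
      rw [ContinuousLinearMap.adjoint_inner_left]
      rw [hsa]
    have h3 : (inner ℂ (x v) (x v) : ℂ) = ((‖x v‖ ^ 2 : ℝ) : ℂ) := by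
      rw [inner_self_eq_norm_sq_to_K]; norm_cast
    simp only [map_sub, map_smul, inner_sub_left, inner_sub_right, inner_smul_left,
      inner_smul_right, h2, h3, Complex.conj_ofReal, Complex.sub_re, Complex.re_ofReal_mul,
      Complex.ofReal_re, h] at h1
    linarith
  have := discrim_le_zero key
  rw [discrim] at this
  have h4 : ‖x v‖ ^ 2 = 0 := by nlinarith [sq_nonneg (‖x v‖ ^ 2)]
  simpa using h4

theorem adj_bound {Θ : Type*} [DecidableEq Θ] (l : Θ → Fock Θ →L[ℂ] Fock Θ)
    (hl : ∀ (i : Θ) (I : List Θ), l i (fockBasis I) = fockBasis (i :: I)) (i : Θ) (w : Fock Θ) :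
    ‖ContinuousLinearMap.adjoint (l i) w‖ ≤ ‖w‖ := by
  have hc : ∀ I, (ContinuousLinearMap.adjoint (l i) w) I = w (i :: I) := by
    intro I
    have h1 := ContinuousLinearMap.adjoint_inner_right (l i) (fockBasis I) w
    rw [hl, fockBasis, fockBasis, lp.inner_single_left, lp.inner_single_left] at h1
    simpa using h1
  have hp : 0 < (2 : ENNReal).toReal := by norm_num
  rw [← Real.rpow_le_rpow_iff (norm_nonneg _) (norm_nonneg _) hp,
    lp.norm_rpow_eq_tsum hp, lp.norm_rpow_eq_tsum hp]
  simp_rw [hc]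
  exact tsum_comp_le_tsum_of_inj (f := fun I => ‖w I‖ ^ (2 : ENNReal).toReal)
    ((lp.memℓp w).summable hp) (fun I => by positivity)
    (i := fun I => i :: I) (List.cons_injective)

/-- If `x` is a positive (self-adjoint with `⟪x v, v⟫ ≥ 0`) harmonic bounded
operator on the Fock space and `⟪x Ω, Ω⟫ = 0`, then `x = 0`. -/
theorem statement8 {Θ : Type*} [Countable Θ] [Nonempty Θ] [DecidableEq Θ]
    (l : Θ → Fock Θ →L[ℂ] Fock Θ)
    (hl : ∀ (i : Θ) (I : List Θ), l i (fockBasis I) = fockBasis (i :: I))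
    (ω : Θ → ℝ) (hω : ∀ i, 0 < ω i) (hω1 : ∑' i, ω i = 1)
    (P : (Fock Θ →L[ℂ] Fock Θ) → (Fock Θ →L[ℂ] Fock Θ))
    (hP : ∀ (x : Fock Θ →L[ℂ] Fock Θ) (v : Fock Θ),
      P x v = ∑' i, (ω i : ℂ) • ((ContinuousLinearMap.adjoint (l i) ∘L x ∘L l i) v))
    (x : Fock Θ →L[ℂ] Fock Θ)
    (hsa : ContinuousLinearMap.adjoint x = x)
    (hpos : ∀ v : Fock Θ, (0 : ℂ) ≤ (inner ℂ (x v) v : ℂ))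
    (hx : P x = x)
    (hΩ : (inner ℂ (x (fockBasis ([] : List Θ))) (fockBasis ([] : List Θ)) : ℂ) = 0) :
    x = 0 := by
  have hs : Summable ω := by
    by_contra h
    rw [tsum_eq_zero_of_not_summable h] at hω1
    exact zero_ne_one hω1
  have hpos' : ∀ v : Fock Θ, 0 ≤ (inner ℂ (x v) v : ℂ).re := fun v => (Complex.le_def.1 (hpos v)).1
  have hnorm : ∀ I : List Θ, ‖(fockBasis I : Fock Θ)‖ = 1 := fun I => by
    rw [fockBasis, lp.norm_single (by norm_num)]; simp
  have step : ∀ I : List Θ, (inner ℂ (x (fockBasis I)) (fockBasis I) : ℂ).re = 0 := by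
    intro I
    induction I with
    | nil => rw [hΩ]; rfl
    | cons i J ih =>
      have hsum : Summable fun i => (ω i : ℂ) •
          ((ContinuousLinearMap.adjoint (l i) ∘L x ∘L l i) (fockBasis J)) := by
        refine Summable.of_norm_bounded (g := fun i => ω i * ‖x‖) (hs.mul_right _) fun i => ?_
        rw [norm_smul, Complex.norm_real, Real.norm_of_nonneg (hω i).le]
        refine mul_le_mul_of_nonneg_left ?_ (hω i).le
        simp only [ContinuousLinearMap.comp_apply, hl]
        refine (adj_bound l hl i _).trans ((x.le_opNorm _).trans ?_)
        rw [hnorm, mul_one]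
      have h1 := hsum.hasSum
      rw [← hP, hx] at h1
      have h2 := Complex.hasSum_re ((innerSL ℂ (fockBasis J)).hasSum h1)
      have h3 : ∀ i, (innerSL ℂ (fockBasis J) ((ω i : ℂ) •
          ((ContinuousLinearMap.adjoint (l i) ∘L x ∘L l i) (fockBasis J)))).re
          = ω i * (inner ℂ (x (fockBasis (i :: J))) (fockBasis (i :: J)) : ℂ).re := by
        intro i
        simp only [ContinuousLinearMap.comp_apply, innerSL_apply_apply, inner_smul_right,
          ContinuousLinearMap.adjoint_inner_right, hl, Complex.re_ofReal_mul]
        congr 1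
        exact inner_re_symm (𝕜 := ℂ) _ _
      simp only [h3] at h2
      have h4 : (innerSL ℂ (fockBasis J) (x (fockBasis J))).re = 0 := by
        rw [← ih, innerSL_apply_apply]
        exact inner_re_symm (𝕜 := ℂ) _ _
      rw [h4, hasSum_zero_iff_of_nonneg fun i => mul_nonneg (hω i).le (hpos' _)] at h2
      have h5 := congrFun h2 i
      exact (mul_eq_zero.1 h5).resolve_left (hω i).ne'
  refine lp.ext_continuousLinearMap (by norm_num) fun I => ?_
  ext
  have := pos_ker x hsa hpos' _ (step I)
  rw [fockBasis] at this
  simp [this]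
end
end

section
/- For all words I, J : List Θ the sequence (P_ω^n(r_I (r_J)*)) converges in SOT to a bounded operator c_{I,J}. Every harmonic bounded operator x on F belongs to the closure, in the weak operator topology, of the linear span of { c_{I,J} : I, J ∈ List Θ }. (This expresses that the Poisson boundary is the σ-weak closure of the Cuntz algebra generated by the right creation operators r_i.) -/
open Filter Topology

noncomputable section

namespace FockAux

open ContinuousLinearMap

variable {Θ : Type*} [DecidableEq Θ]

lemma inner_basis_left (A : List Θ) (v : Fock Θ) : inner ℂ (fockBasis A) v = v A := by
  rw [fockBasis, lp.inner_single_left]; simp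

lemma inner_basis_right (A : List Θ) (v : Fock Θ) :
    inner ℂ v (fockBasis A) = (starRingEnd ℂ) (v A) := by
  rw [fockBasis, lp.inner_single_right]; simp

lemma basis_apply (A B : List Θ) : (fockBasis A : Fock Θ) B = if B = A then 1 else 0 := by
  rw [fockBasis, lp.single_apply, Pi.single_apply]

lemma norm_basis (A : List Θ) : ‖(fockBasis A : Fock Θ)‖ = 1 := by
  rw [fockBasis, lp.norm_single (by norm_num)]; simp

lemma hasSum_basis (v : Fock Θ) : HasSum (fun A => v A • fockBasis A) v := by
  have := lp.hasSum_single (p := 2) (by norm_num) v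
  convert this using 2 with A
  rw [fockBasis, ← lp.single_smul]; simp

/-- matrix entry -/
def ent (x : Fock Θ →L[ℂ] Fock Θ) (A B : List Θ) : ℂ := (x (fockBasis B)) A

lemma ent_eq (x : Fock Θ →L[ℂ] Fock Θ) (A B : List Θ) :
    ent x A B = inner ℂ (fockBasis A) (x (fockBasis B)) := by
  rw [inner_basis_left, ent]

lemma ent_add (x y : Fock Θ →L[ℂ] Fock Θ) (A B : List Θ) :
    ent (x + y) A B = ent x A B + ent y A B := by simp [ent]

lemma ent_smul (a : ℂ) (x : Fock Θ →L[ℂ] Fock Θ) (A B : List Θ) :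
    ent (a • x) A B = a * ent x A B := by simp [ent]

lemma ent_sum {ι : Type*} (s : Finset ι) (x : ι → Fock Θ →L[ℂ] Fock Θ) (A B : List Θ) :
    ent (∑ i ∈ s, x i) A B = ∑ i ∈ s, ent (x i) A B := by
  simp [ent_eq]

lemma norm_ent_le (x : Fock Θ →L[ℂ] Fock Θ) (A B : List Θ) : ‖ent x A B‖ ≤ ‖x‖ := by
  rw [ent_eq]
  calc _ ≤ ‖(fockBasis A : Fock Θ)‖ * ‖x (fockBasis B)‖ := norm_inner_le_norm _ _
    _ ≤ 1 * (‖x‖ * 1) := by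
      rw [norm_basis]; gcongr; simpa [norm_basis] using x.le_opNorm (fockBasis B)
    _ = ‖x‖ := by ring

lemma ext_basis {x y : Fock Θ →L[ℂ] Fock Θ} (h : ∀ B, x (fockBasis B) = y (fockBasis B)) :
    x = y := by
  ext1 v
  have h1 := (hasSum_basis v).mapL x
  have h2 := (hasSum_basis v).mapL y
  refine h1.unique ?_
  simpa [h] using h2

lemma ext_ent {x y : Fock Θ →L[ℂ] Fock Θ} (h : ∀ A B, ent x A B = ent y A B) : x = y :=
  ext_basis fun B => lp.ext (funext fun A => h A B)

lemma ent_conj (l x : Fock Θ →L[ℂ] Fock Θ) (f : List Θ → List Θ)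
    (hl : ∀ I, l (fockBasis I) = fockBasis (f I)) (A B : List Θ) :
    ent (adjoint l ∘L x ∘L l) A B = ent x (f A) (f B) := by
  simp only [ent_eq, coe_comp, Function.comp_apply]
  rw [adjoint_inner_right, hl, hl]

lemma norm_le_one_of (l : Fock Θ →L[ℂ] Fock Θ) (f : List Θ → List Θ) (hf : Function.Injective f)
    (hl : ∀ I, l (fockBasis I) = fockBasis (f I)) : ‖l‖ ≤ 1 := by
  have h : adjoint l ∘L l = 1 := by
    apply ext_ent
    intro A B
    have := ent_conj l 1 f hl A B
    rw [show (adjoint l ∘L l) = adjoint l ∘L 1 ∘L l from rfl, this]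
    simp [ent, basis_apply, hf.eq_iff]
  refine l.opNorm_le_bound zero_le_one fun v => ?_
  have h2 : ‖l v‖ ^ 2 = ‖v‖ ^ 2 := by
    have : inner ℂ (l v) (l v) = inner ℂ v v := by
      rw [← adjoint_inner_right]
      change inner ℂ v ((adjoint l ∘L l) v) = _
      rw [h]; rfl
    rw [inner_self_eq_norm_sq_to_K, inner_self_eq_norm_sq_to_K] at this
    exact_mod_cast this
  rw [one_mul]
  exact (pow_le_pow_iff_left₀ (norm_nonneg _) (norm_nonneg _) two_ne_zero).1 h2.le

lemma norm_sandwich (l x : Fock Θ →L[ℂ] Fock Θ) (hl : ‖l‖ ≤ 1) (v : Fock Θ) :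
    ‖(adjoint l ∘L x ∘L l) v‖ ≤ ‖x‖ * ‖v‖ := by
  have h1 : ‖adjoint l‖ ≤ 1 := by simpa using hl
  calc _ ≤ ‖adjoint l‖ * (‖x‖ * (‖l‖ * ‖v‖)) := by
        refine (le_opNorm (adjoint l) (x (l v))).trans ?_
        gcongr
        refine (le_opNorm x _).trans ?_
        gcongr
        exact le_opNorm _ _
    _ ≤ 1 * (‖x‖ * (1 * ‖v‖)) := by gcongr
    _ = _ := by ring

section P
variable {l : Θ → Fock Θ →L[ℂ] Fock Θ}
    {ω : Θ → ℝ} {P : (Fock Θ →L[ℂ] Fock Θ) → (Fock Θ →L[ℂ] Fock Θ)}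

lemma summable_P (hl : ∀ i, ‖l i‖ ≤ 1) (hω : ∀ i, 0 < ω i) (hs : Summable ω)
    (x : Fock Θ →L[ℂ] Fock Θ) (v : Fock Θ) :
    Summable fun i => (ω i : ℂ) • ((adjoint (l i) ∘L x ∘L l i) v) := by
  refine Summable.of_norm_bounded (hs.mul_right (‖x‖ * ‖v‖)) fun i => ?_
  rw [norm_smul, Complex.norm_real, Real.norm_of_nonneg (hω i).le]
  exact mul_le_mul_of_nonneg_left (norm_sandwich _ _ (hl i) v) (hω i).le

lemma hasSum_P (hl : ∀ i, ‖l i‖ ≤ 1) (hω : ∀ i, 0 < ω i) (hs : Summable ω)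
    (hP : ∀ (x : Fock Θ →L[ℂ] Fock Θ) (v : Fock Θ),
      P x v = ∑' i, (ω i : ℂ) • ((adjoint (l i) ∘L x ∘L l i) v))
    (x : Fock Θ →L[ℂ] Fock Θ) (v : Fock Θ) :
    HasSum (fun i => (ω i : ℂ) • ((adjoint (l i) ∘L x ∘L l i) v)) (P x v) := by
  rw [hP]; exact (summable_P hl hω hs x v).hasSum

lemma norm_P_le (hl : ∀ i, ‖l i‖ ≤ 1) (hω : ∀ i, 0 < ω i) (hs : HasSum ω 1)
    (hP : ∀ (x : Fock Θ →L[ℂ] Fock Θ) (v : Fock Θ),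
      P x v = ∑' i, (ω i : ℂ) • ((adjoint (l i) ∘L x ∘L l i) v))
    (x : Fock Θ →L[ℂ] Fock Θ) : ‖P x‖ ≤ ‖x‖ := by
  refine opNorm_le_bound _ (norm_nonneg _) fun v => ?_
  rw [hP]
  have := hs.mul_right (‖x‖ * ‖v‖)
  rw [one_mul] at this
  refine tsum_of_norm_bounded this fun i => ?_
  rw [norm_smul, Complex.norm_real, Real.norm_of_nonneg (hω i).le]
  exact mul_le_mul_of_nonneg_left (norm_sandwich _ _ (hl i) v) (hω i).le

lemma exists_linear (hl : ∀ i, ‖l i‖ ≤ 1) (hω : ∀ i, 0 < ω i) (hs : Summable ω)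
    (hP : ∀ (x : Fock Θ →L[ℂ] Fock Θ) (v : Fock Θ),
      P x v = ∑' i, (ω i : ℂ) • ((adjoint (l i) ∘L x ∘L l i) v)) :
    ∃ Q : Module.End ℂ (Fock Θ →L[ℂ] Fock Θ), P = Q := by
  refine ⟨{ toFun := P, map_add' := fun x y => ?_, map_smul' := fun a x => ?_ }, rfl⟩
  · ext1 v
    refine (hasSum_P hl hω hs hP (x + y) v).unique ?_
    have h := (hasSum_P hl hω hs hP x v).add (hasSum_P hl hω hs hP y v)
    have e : (fun i => (ω i : ℂ) • ((adjoint (l i) ∘L (x + y) ∘L l i) v)) = fun i =>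
        (ω i : ℂ) • ((adjoint (l i) ∘L x ∘L l i) v) +
          (ω i : ℂ) • ((adjoint (l i) ∘L y ∘L l i) v) := by
      funext i; simp
    rw [e]; exact h
  · ext1 v
    refine (hasSum_P hl hω hs hP (a • x) v).unique ?_
    have h := (hasSum_P hl hω hs hP x v).const_smul a
    have e : (fun i => (ω i : ℂ) • ((adjoint (l i) ∘L (a • x) ∘L l i) v)) = fun i =>
        a • (ω i : ℂ) • ((adjoint (l i) ∘L x ∘L l i) v) := by
      funext i
      rw [smul_comm a]
      simp
    rw [e]; exact h

lemma ent_P (hl : ∀ i, ‖l i‖ ≤ 1) (hω : ∀ i, 0 < ω i) (hs : Summable ω)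
    (hP : ∀ (x : Fock Θ →L[ℂ] Fock Θ) (v : Fock Θ),
      P x v = ∑' i, (ω i : ℂ) • ((adjoint (l i) ∘L x ∘L l i) v))
    (hl' : ∀ (i : Θ) (I : List Θ), l i (fockBasis I) = fockBasis (i :: I))
    (x : Fock Θ →L[ℂ] Fock Θ) (A B : List Θ) :
    HasSum (fun i => (ω i : ℂ) * ent x (i :: A) (i :: B)) (ent (P x) A B) := by
  have h := (hasSum_P hl hω hs hP x (fockBasis B)).mapL (innerSL ℂ (fockBasis A))
  rw [ent_eq]
  have e : (fun i => (ω i : ℂ) * ent x (i :: A) (i :: B)) = fun i =>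
      innerSL ℂ (fockBasis A) ((ω i : ℂ) • ((adjoint (l i) ∘L x ∘L l i) (fockBasis B))) := by
    funext i
    rw [← ent_conj (l i) x (fun I => i :: I) (hl' i), ent_eq]
    simp only [innerSL_apply_apply, inner_smul_right]
  rw [e]; exact h
end P

lemma wordOp_basis {r : Θ → Fock Θ →L[ℂ] Fock Θ}
    (hr : ∀ (i : Θ) (I : List Θ), r i (fockBasis I) = fockBasis (I ++ [i])) (I K : List Θ) :
    wordOp r I (fockBasis K) = fockBasis (K ++ I.reverse) := by
  induction I with
  | nil => simp [wordOp]
  | cons i I ih => simp [wordOp, ih, hr]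

lemma adj_apply {R : Fock Θ →L[ℂ] Fock Θ} {S : List Θ}
    (hR : ∀ K, R (fockBasis K) = fockBasis (K ++ S)) (v : Fock Θ) (K : List Θ) :
    (adjoint R v) K = v (K ++ S) := by
  rw [← inner_basis_left, adjoint_inner_right, hR, inner_basis_left]

section V
variable {R R' : Fock Θ →L[ℂ] Fock Θ} {S T : List Θ}

lemma ent_V_append
    (hR : ∀ K, R (fockBasis K) = fockBasis (K ++ S))
    (hR' : ∀ K, R' (fockBasis K) = fockBasis (K ++ T))
    (A K : List Θ) :
    ent (R ∘L adjoint R') A (K ++ T) = if A = K ++ S then 1 else 0 := by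
  have : adjoint R' (fockBasis (K ++ T)) = fockBasis K := by
    apply lp.ext; funext K'
    rw [adj_apply hR', basis_apply, basis_apply]; simp
  rw [ent, comp_apply, this, hR, basis_apply]

lemma ent_V_not
    (hR' : ∀ K, R' (fockBasis K) = fockBasis (K ++ T))
    (A B : List Θ) (h : ¬ T <:+ B) : ent (R ∘L adjoint R') A B = 0 := by
  have : adjoint R' (fockBasis B) = 0 := by
    apply lp.ext; funext K'
    rw [adj_apply hR', basis_apply, if_neg]
    · rfl
    · rintro rfl; exact h (List.suffix_append _ _)
  rw [ent, comp_apply, this, map_zero]; rfl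

lemma ent_V_cons
    (hR : ∀ K, R (fockBasis K) = fockBasis (K ++ S))
    (hR' : ∀ K, R' (fockBasis K) = fockBasis (K ++ T))
    (A B : List Θ) (i : Θ) (h : T.length ≤ B.length) :
    ent (R ∘L adjoint R') (i :: A) (i :: B) = ent (R ∘L adjoint R') A B := by
  by_cases hT : T <:+ B
  · obtain ⟨K, rfl⟩ := hT
    rw [← List.cons_append, ent_V_append hR hR', ent_V_append hR hR']
    simp
  · rw [ent_V_not hR' _ _ hT, ent_V_not hR']
    rw [List.suffix_cons_iff]
    rintro (rfl | h')
    · simp at h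
    · exact hT h'

variable {Q : (Fock Θ →L[ℂ] Fock Θ) → (Fock Θ →L[ℂ] Fock Θ)} {ω : Θ → ℝ}

lemma ent_stable
    (hR : ∀ K, R (fockBasis K) = fockBasis (K ++ S))
    (hR' : ∀ K, R' (fockBasis K) = fockBasis (K ++ T))
    (hs : HasSum ω 1)
    (hQ : ∀ x A B, HasSum (fun i => (ω i : ℂ) * ent x (i :: A) (i :: B)) (ent (Q x) A B))
    (n : ℕ) (A B : List Θ) (h : T.length ≤ B.length + n) :
    ent (Q^[n + 1] (R ∘L adjoint R')) A B = ent (Q^[n] (R ∘L adjoint R')) A B := by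
  induction n generalizing A B with
  | zero =>
    have h1 := hQ (R ∘L adjoint R') A B
    simp only [ent_V_cons hR hR' A B _ (by simpa using h)] at h1
    have h2 := (Complex.hasSum_ofReal.2 hs).mul_right (ent (R ∘L adjoint R') A B)
    simpa using h1.unique h2
  | succ n ih =>
    rw [Function.iterate_succ_apply', Function.iterate_succ_apply' Q n]
    refine (hQ _ A B).unique ?_
    have := hQ (Q^[n] (R ∘L adjoint R')) A B
    convert this using 3 with i
    rw [← Function.iterate_succ_apply' Q n]; exact ih (i :: A) (i :: B) (by rw [List.length_cons]; omega)

lemma ent_iter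
    (hR : ∀ K, R (fockBasis K) = fockBasis (K ++ S))
    (hR' : ∀ K, R' (fockBasis K) = fockBasis (K ++ T))
    (hs : HasSum ω 1)
    (hQ : ∀ x A B, HasSum (fun i => (ω i : ℂ) * ent x (i :: A) (i :: B)) (ent (Q x) A B))
    (n : ℕ) (A B : List Θ) (h : T.length ≤ B.length) :
    ent (Q^[n] (R ∘L adjoint R')) A B = ent (R ∘L adjoint R') A B := by
  induction n with
  | zero => rfl
  | succ n ih => rw [ent_stable hR hR' hs hQ n A B (by omega), ih]

lemma iter_const
    (hR : ∀ K, R (fockBasis K) = fockBasis (K ++ S))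
    (hR' : ∀ K, R' (fockBasis K) = fockBasis (K ++ T))
    (hs : HasSum ω 1)
    (hQ : ∀ x A B, HasSum (fun i => (ω i : ℂ) * ent x (i :: A) (i :: B)) (ent (Q x) A B))
    (n : ℕ) (h : T.length ≤ n) :
    Q^[n] (R ∘L adjoint R') = Q^[T.length] (R ∘L adjoint R') := by
  induction n, h using Nat.le_induction with
  | base => rfl
  | succ n hn ih =>
    rw [← ih]
    exact ext_ent fun A B => ent_stable hR hR' hs hQ n A B (by omega)

lemma ent_c_base
    (hR : ∀ K, R (fockBasis K) = fockBasis (K ++ S))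
    (hR' : ∀ K, R' (fockBasis K) = fockBasis (K ++ T))
    (hs : HasSum ω 1)
    (hQ : ∀ x A B, HasSum (fun i => (ω i : ℂ) * ent x (i :: A) (i :: B)) (ent (Q x) A B))
    (A B : List Θ) (h : B.length = T.length) :
    ent (Q^[T.length] (R ∘L adjoint R')) A B = if A = S ∧ B = T then 1 else 0 := by
  rw [ent_iter hR hR' hs hQ _ _ _ h.ge]
  by_cases hT : T <:+ B
  · have := hT.eq_of_length h.symm
    subst this
    simpa using ent_V_append hR hR' A []
  · rw [ent_V_not hR' _ _ hT, if_neg]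
    rintro ⟨-, rfl⟩; exact hT (List.suffix_refl _)

end V

section Z

/-- the degree-`j` part of the approximant -/
def Zop (x : Fock Θ →L[ℂ] Fock Θ) (cc : List Θ → List Θ → Fock Θ →L[ℂ] Fock Θ) (n j : ℕ)
    (W : Finset (List Θ)) : Fock Θ →L[ℂ] Fock Θ :=
  ∑ q ∈ (W ×ˢ W).filter (fun q => q.2.length = j ∧ n ≤ q.1.length ∧ q.1.length < 2 * n),
    ent x q.1 q.2 • cc q.1 q.2

variable {x : Fock Θ →L[ℂ] Fock Θ} {cc : List Θ → List Θ → Fock Θ →L[ℂ] Fock Θ} {n j : ℕ}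

lemma Z_base (hb : ∀ S T A B, B.length = T.length →
      ent (cc S T) A B = if A = S ∧ B = T then 1 else 0)
    (W : Finset (List Θ)) (A B : List Θ) (hB : B.length = j) :
    ent (Zop x cc n j W) A B =
      if A ∈ W ∧ B ∈ W ∧ n ≤ A.length ∧ A.length < 2 * n then ent x A B else 0 := by
  rw [Zop, ent_sum]
  have : ∀ q ∈ (W ×ˢ W).filter
      (fun q => q.2.length = j ∧ n ≤ q.1.length ∧ q.1.length < 2 * n),
      ent (ent x q.1 q.2 • cc q.1 q.2) A B = if (A, B) = q then ent x A B else 0 := by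
    rintro ⟨S, T⟩ hq
    simp only [Finset.mem_filter] at hq
    rw [ent_smul, hb _ _ _ _ (hB.trans hq.2.1.symm)]
    by_cases h : A = S ∧ B = T
    · obtain ⟨rfl, rfl⟩ := h; simp
    · simp [h]
  rw [Finset.sum_congr rfl this, Finset.sum_ite_eq]
  simp [hB, and_assoc]

variable {Q : Module.End ℂ (Fock Θ →L[ℂ] Fock Θ)} {ω : Θ → ℝ}

lemma Z_main (hω : ∀ i, 0 < ω i) (hs : HasSum ω 1)
    (hQ : ∀ x A B, HasSum (fun i => (ω i : ℂ) * ent x (i :: A) (i :: B)) (ent (Q x) A B))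
    (hb : ∀ S T A B, B.length = T.length →
      ent (cc S T) A B = if A = S ∧ B = T then 1 else 0)
    (hc : ∀ S T, Q (cc S T) = cc S T) (hx : Q x = x) (k : ℕ) (A B : List Θ)
    (hB : B.length + k = j) :
    (∀ W, ‖ent (Zop x cc n j W) A B‖ ≤ ‖x‖) ∧
    Tendsto (fun W => ent (Zop x cc n j W) A B) atTop
      (𝓝 (if n ≤ A.length + k ∧ A.length + k < 2 * n then ent x A B else 0)) := by
  induction k generalizing A B with
  | zero =>
    simp only [Z_base hb _ A B hB]
    constructor
    · intro W
      split_ifs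
      · exact norm_ent_le _ _ _
      · simp
    · refine tendsto_const_nhds.congr' ?_
      filter_upwards [eventually_ge_atTop ({A, B} : Finset (List Θ))] with W hW
      have hA : A ∈ W := hW (by simp)
      have hB : B ∈ W := hW (by simp)
      simp [hA, hB]
  | succ k ih =>
    have hZ : ∀ W, Q (Zop x cc n j W) = Zop x cc n j W := by
      intro W; simp [Zop, hc]
    have hZs : ∀ W, HasSum (fun i => (ω i : ℂ) * ent (Zop x cc n j W) (i :: A) (i :: B))
        (ent (Zop x cc n j W) A B) := by
      intro W
      have := hQ (Zop x cc n j W) A B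
      rwa [hZ] at this
    have ih' := fun i => ih (i :: A) (i :: B) (by simp; omega)
    have hbd : ∀ W i, ‖(ω i : ℂ) * ent (Zop x cc n j W) (i :: A) (i :: B)‖ ≤ ω i * ‖x‖ := by
      intro W i
      rw [norm_mul, Complex.norm_real, Real.norm_of_nonneg (hω i).le]
      exact mul_le_mul_of_nonneg_left ((ih' i).1 W) (hω i).le
    constructor
    · intro W
      rw [← (hZs W).tsum_eq]
      refine tsum_of_norm_bounded ?_ (hbd W)
      simpa using hs.mul_right ‖x‖
    · have h1 := tendsto_tsum_of_dominated_convergence (𝓕 := atTop)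
        (f := fun W i => (ω i : ℂ) * ent (Zop x cc n j W) (i :: A) (i :: B))
        (hs.summable.mul_right ‖x‖) (fun i => ((ih' i).2.const_mul (ω i : ℂ)))
        (Eventually.of_forall hbd)
      simp only [fun W => (hZs W).tsum_eq] at h1
      convert h1 using 2
      have hx' := hQ x A B
      rw [hx] at hx'
      have e : ∀ i : Θ, (i :: A).length + k = A.length + (k + 1) := by
        intro i; simp; omega
      simp only [e]
      split_ifs with h
      · exact hx'.tsum_eq.symm
      · simp

end Z

section N

lemma hasSum_norm_sq (v : Fock Θ) : HasSum (fun A => ‖v A‖ ^ 2) (‖v‖ ^ 2) := by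
  have := lp.hasSum_norm (p := 2) (by norm_num) v
  simpa using this

variable {R : List Θ → Fock Θ →L[ℂ] Fock Θ}

lemma bessel_level
    (hR : ∀ S K, R S (fockBasis K) = fockBasis (K ++ S))
    (w : Fock Θ) (U : Finset (List Θ)) (j : ℕ) (hU : ∀ S ∈ U, S.length = j) :
    ∑ S ∈ U, ‖adjoint (R S) w‖ ^ 2 ≤ ‖w‖ ^ 2 := by
  have h1 : HasSum (fun K => ∑ S ∈ U, ‖w (K ++ S)‖ ^ 2) (∑ S ∈ U, ‖adjoint (R S) w‖ ^ 2) := by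
    refine hasSum_sum fun S _ => ?_
    simpa only [adj_apply (hR S)] using hasSum_norm_sq (adjoint (R S) w)
  refine hasSum_le_of_sum_le h1 fun t => ?_
  rw [← Finset.sum_product' (f := fun K S => ‖w (K ++ S)‖ ^ 2)]
  have hinj : Set.InjOn (fun p : List Θ × List Θ => p.1 ++ p.2) (t ×ˢ U : Finset _) := by
    rintro ⟨K, S⟩ h ⟨K', S'⟩ h' e
    simp only [Finset.coe_product, Set.mem_prod, Finset.mem_coe] at h h'
    have := List.append_inj' e ((hU S h.2).trans (hU S' h'.2).symm)
    exact Prod.ext this.1 this.2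
  rw [← Finset.sum_image (g := fun p : List Θ × List Θ => p.1 ++ p.2)
    (f := fun B => ‖w B‖ ^ 2) hinj]
  exact sum_le_hasSum _ (fun _ _ => by positivity) (hasSum_norm_sq w)

lemma bessel_window
    (hR : ∀ S K, R S (fockBasis K) = fockBasis (K ++ S))
    (w : Fock Θ) (U : Finset (List Θ)) (n : ℕ)
    (hU : ∀ S ∈ U, n ≤ S.length ∧ S.length < 2 * n) :
    ∑ S ∈ U, ‖adjoint (R S) w‖ ^ 2 ≤ n * ‖w‖ ^ 2 := by
  rw [← Finset.sum_fiberwise_of_maps_to (t := Finset.Ico n (2 * n)) (g := List.length)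
    (fun S hS => by simpa using hU S hS)]
  refine (Finset.sum_le_card_nsmul _ _ (‖w‖ ^ 2) fun j _ =>
    bessel_level hR w _ j fun S hS => (Finset.mem_filter.1 hS).2).trans ?_
  rw [Nat.card_Ico, nsmul_eq_mul, show 2 * n - n = n by omega]

lemma sesq_bound
    (hR : ∀ S K, R S (fockBasis K) = fockBasis (K ++ S))
    (x : Fock Θ →L[ℂ] Fock Θ) (U : Finset (List Θ)) (n : ℕ)
    (hU : ∀ S ∈ U, n ≤ S.length ∧ S.length < 2 * n) (v w : Fock Θ) :
    ‖inner ℂ w ((∑ q ∈ U ×ˢ U, ent x q.1 q.2 • (R q.1 ∘L adjoint (R q.2))) v)‖ ≤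
      ‖x‖ / 2 * (n * (‖w‖ ^ 2 + ‖v‖ ^ 2)) := by
  let a : Fock Θ → List Θ → Fock Θ := fun w K => ∑ S ∈ U, w (K ++ S) • fockBasis S
  have ha : ∀ w K, ‖a w K‖ ^ 2 = ∑ S ∈ U, ‖w (K ++ S)‖ ^ 2 := by
    intro w K
    have := lp.norm_sum_single (p := 2) (E := fun _ : List Θ => ℂ) (by norm_num)
      (fun S => w (K ++ S)) U
    simp only [ENNReal.toReal_ofNat, Real.rpow_ofNat] at this
    rw [← this]
    congr 2
    refine Finset.sum_congr rfl fun S _ => ?_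
    rw [fockBasis, ← lp.single_smul]; simp
  have has : ∀ w, HasSum (fun K => ‖a w K‖ ^ 2) (∑ S ∈ U, ‖adjoint (R S) w‖ ^ 2) := by
    intro w
    simp only [ha]
    refine hasSum_sum fun S _ => ?_
    simpa only [adj_apply (hR S)] using hasSum_norm_sq (adjoint (R S) w)
  have h1 : HasSum (fun K => inner ℂ (a w K) (x (a v K)))
      (inner ℂ w ((∑ q ∈ U ×ˢ U, ent x q.1 q.2 • (R q.1 ∘L adjoint (R q.2))) v)) := by
    have h2 : HasSum (fun K => ∑ q ∈ U ×ˢ U, ent x q.1 q.2 *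
        inner ℂ (w (K ++ q.1)) (v (K ++ q.2)))
        (∑ q ∈ U ×ˢ U, ent x q.1 q.2 * inner ℂ (adjoint (R q.1) w) (adjoint (R q.2) v)) := by
      refine hasSum_sum fun q _ => HasSum.mul_left _ ?_
      simpa only [adj_apply (hR _)] using lp.hasSum_inner (adjoint (R q.1) w) (adjoint (R q.2) v)
    convert h2 using 1
    · funext K
      simp only [a, map_sum, map_smul, sum_inner, inner_sum, inner_smul_left, inner_smul_right,
        ← ent_eq]
      rw [Finset.sum_product_right]
      refine Finset.sum_congr rfl fun S _ => ?_
      rw [Finset.mul_sum]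
      refine Finset.sum_congr rfl fun T _ => ?_
      simp only [RCLike.inner_apply]
      ring
    · simp only [_root_.sum_apply, inner_sum, smul_apply, inner_smul_right, comp_apply,
        adjoint_inner_left]
  have hb : ∀ K, ‖inner ℂ (a w K) (x (a v K))‖ ≤ ‖x‖ / 2 * (‖a w K‖ ^ 2 + ‖a v K‖ ^ 2) := by
    intro K
    calc _ ≤ ‖a w K‖ * (‖x‖ * ‖a v K‖) :=
          (norm_inner_le_norm _ _).trans (by gcongr; exact le_opNorm _ _)
      _ ≤ _ := by nlinarith [norm_nonneg x, mul_nonneg (norm_nonneg x) (sq_nonneg (‖a w K‖ - ‖a v K‖))]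
  rw [← h1.tsum_eq]
  refine (tsum_of_norm_bounded (((has w).add (has v)).mul_left (‖x‖ / 2)) hb).trans ?_
  have b1 := bessel_window hR w U n hU
  have b2 := bessel_window hR v U n hU
  gcongr
  linarith

lemma norm_le_of_sesq (X : Fock Θ →L[ℂ] Fock Θ) (C : ℝ) (hC : 0 ≤ C)
    (h : ∀ v w, ‖inner ℂ w (X v)‖ ≤ C / 2 * (‖w‖ ^ 2 + ‖v‖ ^ 2)) : ‖X‖ ≤ C := by
  refine opNorm_le_bound _ hC fun v => ?_
  by_cases hv : X v = 0
  · rw [hv, norm_zero]; positivity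
  have hp : 0 < ‖X v‖ := norm_pos_iff.2 hv
  have hvp : 0 < ‖v‖ := norm_pos_iff.2 (by rintro rfl; simp at hv)
  have := h v (((‖v‖ / ‖X v‖ : ℝ) : ℂ) • X v)
  rw [inner_smul_left, inner_self_eq_norm_sq_to_K, norm_smul, norm_mul] at this
  simp only [Complex.conj_ofReal, Complex.norm_real, norm_div, norm_norm, norm_pow,
    Complex.coe_algebraMap] at this
  rw [div_mul_cancel₀ _ hp.ne'] at this
  have e : ‖v‖ / ‖X v‖ * ‖X v‖ ^ 2 = ‖v‖ * ‖X v‖ := by field_simp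
  rw [e] at this
  have : ‖v‖ * ‖X v‖ ≤ ‖v‖ * (C * ‖v‖) := by nlinarith
  exact le_of_mul_le_mul_left this hvp

lemma norm_X
    (hR : ∀ S K, R S (fockBasis K) = fockBasis (K ++ S))
    (x : Fock Θ →L[ℂ] Fock Θ) (U : Finset (List Θ)) (n : ℕ) (hn : 0 < n)
    (hU : ∀ S ∈ U, n ≤ S.length ∧ S.length < 2 * n) :
    ‖(n : ℂ)⁻¹ • ∑ q ∈ U ×ˢ U, ent x q.1 q.2 • (R q.1 ∘L adjoint (R q.2))‖ ≤ ‖x‖ := by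
  refine norm_le_of_sesq _ _ (norm_nonneg _) fun v w => ?_
  have := sesq_bound hR x U n hU v w
  rw [smul_apply, inner_smul_right, norm_mul, norm_inv, Complex.norm_natCast]
  have hn' : (0 : ℝ) < n := by exact_mod_cast hn
  rw [inv_mul_le_iff₀ hn']
  linarith

end N

section WOT

lemma tendsto_functional {ι : Type*} {F : Filter ι} (φ : ι → Fock Θ →L[ℂ] ℂ) (C : ℝ)
    (hC : ∀ i, ‖φ i‖ ≤ C) (h : ∀ B, Tendsto (fun i => φ i (fockBasis B)) F (𝓝 0)) (v : Fock Θ) :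
    Tendsto (fun i => φ i v) F (𝓝 0) := by
  rw [Metric.tendsto_nhds]
  intro ε hε
  have hC' : 0 < |C| + 1 := by positivity
  obtain ⟨s, hs⟩ := ((Metric.tendsto_nhds.1 (hasSum_basis v)) (ε / (2 * (|C| + 1)))
    (by positivity)).exists
  have h1 : Tendsto (fun i => φ i (∑ A ∈ s, v A • fockBasis A)) F (𝓝 0) := by
    simp only [map_sum, map_smul]
    have := tendsto_finsetSum s fun A _ => (h A).const_smul (v A)
    simpa using this
  filter_upwards [Metric.tendsto_nhds.1 h1 (ε / 2) (by positivity)] with i hi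
  rw [dist_zero_right] at hi ⊢
  rw [dist_comm, dist_eq_norm] at hs
  have h2 : ‖φ i (v - ∑ A ∈ s, v A • fockBasis A)‖ ≤ ε / 2 := by
    calc _ ≤ ‖φ i‖ * ‖v - ∑ A ∈ s, v A • fockBasis A‖ := le_opNorm _ _
      _ ≤ (|C| + 1) * (ε / (2 * (|C| + 1))) := by
        gcongr
        linarith [hC i, le_abs_self C]
      _ = ε / 2 := by field_simp
  have : φ i v = φ i (v - ∑ A ∈ s, v A • fockBasis A) + φ i (∑ A ∈ s, v A • fockBasis A) := by
    rw [← map_add]; simp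
  rw [this]
  linarith [norm_add_le (φ i (v - ∑ A ∈ s, v A • fockBasis A))
    (φ i (∑ A ∈ s, v A • fockBasis A))]

lemma tendsto_sesq {ι : Type*} {F : Filter ι} (z : ι → Fock Θ →L[ℂ] Fock Θ) (C : ℝ)
    (hC : ∀ i, ‖z i‖ ≤ C) (h : ∀ A B, Tendsto (fun i => ent (z i) A B) F (𝓝 0)) (v w : Fock Θ) :
    Tendsto (fun i => inner ℂ w (z i v)) F (𝓝 0) := by
  have h1 : ∀ A, Tendsto (fun i => inner ℂ (fockBasis A) (z i v)) F (𝓝 0) := by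
    intro A
    refine tendsto_functional (fun i => (innerSL ℂ (fockBasis A)) ∘L z i) C (fun i => ?_)
      (fun B => ?_) v
    · refine (opNorm_comp_le _ _).trans ?_
      rw [innerSL_apply_norm, norm_basis, one_mul]; exact hC i
    · simpa [ent_eq] using h A B
  have h2 : Tendsto (fun i => inner ℂ (z i v) w) F (𝓝 0) := by
    refine tendsto_functional (fun i => innerSL ℂ (z i v)) (C * ‖v‖) (fun i => ?_) (fun B => ?_) w
    · rw [innerSL_apply_norm]
      exact (le_opNorm _ _).trans (by gcongr; exact hC i)
    · have := (Complex.continuous_conj.tendsto _).comp (h1 B)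
      simpa [Function.comp_def] using this
  have := (Complex.continuous_conj.tendsto _).comp h2
  simpa [Function.comp_def] using this

lemma mem_closure_WOT (x : Fock Θ →L[ℂ] Fock Θ) (M : Set (Fock Θ →WOT[ℂ] Fock Θ)) (C : ℝ)
    (h : ∀ (D : Finset (List Θ)) (ε : ℝ), 0 < ε → ∃ y : Fock Θ →L[ℂ] Fock Θ,
      ContinuousLinearMapWOT.ofCLM y ∈ M ∧ ‖y‖ ≤ C ∧
        ∀ A ∈ D, ∀ B ∈ D, ‖ent y A B - ent x A B‖ ≤ ε) :
    ContinuousLinearMapWOT.ofCLM x ∈ closure M := by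
  choose y hyM hyC hyE using fun p : Finset (List Θ) × ℕ =>
    h p.1 (1 / ((p.2 : ℝ) + 1)) (by positivity)
  refine mem_closure_of_tendsto (b := atTop) (f := fun p => ContinuousLinearMapWOT.ofCLM (y p)) ?_
    (Eventually.of_forall hyM)
  rw [ContinuousLinearMapWOT.tendsto_iff_forall_inner_apply_tendsto]
  intro v w
  have h1 := tendsto_sesq (F := atTop) (fun p => y p - x) (C + ‖x‖)
    (fun p => (norm_sub_le _ _).trans (by gcongr; exact hyC p)) (fun A B => ?_) v w
  · have h2 := h1.add_const (inner ℂ w (x v))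
    simpa [inner_sub_right] using h2
  · have h3 : Tendsto (fun p : Finset (List Θ) × ℕ => 1 / ((p.2 : ℝ) + 1)) atTop (𝓝 0) := by
      have : Tendsto (Prod.snd : Finset (List Θ) × ℕ → ℕ) atTop atTop := by
        rw [← prod_atTop_atTop_eq]; exact tendsto_snd
      exact tendsto_one_div_add_atTop_nhds_zero_nat.comp this
    refine squeeze_zero_norm' ?_ h3
    filter_upwards [eventually_ge_atTop (({A, B} : Finset (List Θ)), 0)] with p hp
    have hA : A ∈ p.1 := hp.1 (by simp)
    have hB : B ∈ p.1 := hp.1 (by simp)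
    have := hyE p A hA B hB
    simpa [ent, sub_apply] using this

end WOT

section Final

lemma Y_eq_sum_Z (x : Fock Θ →L[ℂ] Fock Θ) (cc : List Θ → List Θ → Fock Θ →L[ℂ] Fock Θ) (n : ℕ)
    (W U : Finset (List Θ)) (hU : U = W.filter fun S => n ≤ S.length ∧ S.length < 2 * n) :
    ∑ q ∈ U ×ˢ U, ent x q.1 q.2 • cc q.1 q.2 =
      ∑ j ∈ Finset.Ico n (2 * n), Zop x cc n j W := by
  rw [← Finset.sum_fiberwise_of_maps_to (t := Finset.Ico n (2 * n))
    (g := fun q : List Θ × List Θ => q.2.length)]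
  · refine Finset.sum_congr rfl fun j hj => ?_
    rw [Zop]
    refine Finset.sum_congr ?_ fun _ _ => rfl
    ext ⟨S, T⟩
    simp only [Finset.mem_Ico] at hj
    simp only [hU, Finset.mem_filter, Finset.mem_product]
    constructor
    · rintro ⟨⟨⟨a, b⟩, c, d⟩, e⟩; exact ⟨⟨a, c⟩, e, b⟩
    · rintro ⟨⟨a, c⟩, e, b⟩; exact ⟨⟨⟨a, b⟩, c, by omega⟩, e⟩
  · rintro ⟨S, T⟩ hq
    simp only [hU, Finset.mem_filter, Finset.mem_product] at hq
    simpa using hq.2.2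

lemma fejer_bound (n a b : ℕ) (hn : 0 < n) (z : ℂ) (hb : b ≤ n) :
    ‖(n : ℂ)⁻¹ * ∑ j ∈ Finset.Ico n (2 * n),
      (if n ≤ a + (j - b) ∧ a + (j - b) < 2 * n then z else 0) - z‖ ≤ (a + b) / n * ‖z‖ := by
  have hn' : (n : ℂ) ≠ 0 := by exact_mod_cast hn.ne'
  have hnr : (0 : ℝ) < n := by exact_mod_cast hn
  have e : (n : ℂ)⁻¹ * ∑ j ∈ Finset.Ico n (2 * n),
      (if n ≤ a + (j - b) ∧ a + (j - b) < 2 * n then z else 0) - z =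
      -((n : ℂ)⁻¹ * ∑ j ∈ Finset.Ico n (2 * n),
        (if ¬ (n ≤ a + (j - b) ∧ a + (j - b) < 2 * n) then z else 0)) := by
    have h1 : ∑ j ∈ Finset.Ico n (2 * n),
        (if n ≤ a + (j - b) ∧ a + (j - b) < 2 * n then z else 0) +
        ∑ j ∈ Finset.Ico n (2 * n),
        (if ¬ (n ≤ a + (j - b) ∧ a + (j - b) < 2 * n) then z else 0) = n * z := by
      rw [← Finset.sum_add_distrib]
      have : ∀ j ∈ Finset.Ico n (2 * n), ((if n ≤ a + (j - b) ∧ a + (j - b) < 2 * n then z else 0)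
          + (if ¬ (n ≤ a + (j - b) ∧ a + (j - b) < 2 * n) then z else 0)) = z := by
        intro j _; by_cases h : n ≤ a + (j - b) ∧ a + (j - b) < 2 * n <;> simp [h]
      rw [Finset.sum_congr rfl this, Finset.sum_const, Nat.card_Ico, nsmul_eq_mul,
        show 2 * n - n = n by omega]
    rw [eq_sub_of_add_eq h1]
    field_simp
    ring
  rw [e, norm_neg, norm_mul, norm_inv, Complex.norm_natCast, ← Finset.sum_filter,
    Finset.sum_const, nsmul_eq_mul, norm_mul, Complex.norm_natCast]
  have hcard : ((Finset.Ico n (2 * n)).filter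
      fun j => ¬ (n ≤ a + (j - b) ∧ a + (j - b) < 2 * n)).card ≤ a + b := by
    calc _ ≤ (Finset.Ico n (n + b) ∪ Finset.Ico (2 * n - a) (2 * n)).card := by
          apply Finset.card_le_card
          intro j hj
          simp only [Finset.mem_filter, Finset.mem_Ico, Finset.mem_union] at hj ⊢
          omega
      _ ≤ _ := by
          refine (Finset.card_union_le _ _).trans ?_
          simp only [Nat.card_Ico]
          omega
  have hcard' : (((Finset.Ico n (2 * n)).filter
      fun j => ¬ (n ≤ a + (j - b) ∧ a + (j - b) < 2 * n)).card : ℝ) ≤ a + b := by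
    exact_mod_cast hcard
  rw [← mul_assoc, inv_mul_eq_div]
  gcongr

variable {x : Fock Θ →L[ℂ] Fock Θ} {Q : Module.End ℂ (Fock Θ →L[ℂ] Fock Θ)} {ω : Θ → ℝ}
  {R : List Θ → Fock Θ →L[ℂ] Fock Θ}

lemma main_approx (hω : ∀ i, 0 < ω i) (hs : HasSum ω 1)
    (hQ : ∀ x A B, HasSum (fun i => (ω i : ℂ) * ent x (i :: A) (i :: B)) (ent (Q x) A B))
    (hN : ∀ x, ‖Q x‖ ≤ ‖x‖)
    (hR : ∀ S K, R S (fockBasis K) = fockBasis (K ++ S))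
    (hx : Q x = x) (D : Finset (List Θ)) (ε : ℝ) (hε : 0 < ε) :
    ∃ y : Fock Θ →L[ℂ] Fock Θ,
      (∃ (n : ℕ) (U : Finset (List Θ)), y = (n : ℂ)⁻¹ • ∑ q ∈ U ×ˢ U, ent x q.1 q.2 •
        Q^[q.2.length] (R q.1 ∘L adjoint (R q.2))) ∧ ‖y‖ ≤ ‖x‖ ∧
        ∀ A ∈ D, ∀ B ∈ D, ‖ent y A B - ent x A B‖ ≤ ε := by
  set cc : List Θ → List Θ → Fock Θ →L[ℂ] Fock Θ := fun S T =>
    Q^[T.length] (R S ∘L adjoint (R T)) with hcc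
  have hb : ∀ S T A B, B.length = T.length →
      ent (cc S T) A B = if A = S ∧ B = T then 1 else 0 := fun S T A B h =>
    ent_c_base (hR S) (hR T) hs hQ A B h
  have hc : ∀ S T, Q (cc S T) = cc S T := by
    intro S T
    have := iter_const (hR S) (hR T) hs hQ (T.length + 1) (by omega)
    rwa [Function.iterate_succ_apply'] at this
  have hcN : ∀ S T (N : ℕ), T.length ≤ N → (Q ^ N) (R S ∘L adjoint (R T)) = cc S T := by
    intro S T N h
    rw [Module.End.pow_apply]
    exact iter_const (hR S) (hR T) hs hQ N h
  have hNN : ∀ (N : ℕ) z, ‖(Q ^ N) z‖ ≤ ‖z‖ := by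
    intro N z
    rw [Module.End.pow_apply]
    induction N with
    | zero => simp
    | succ N ih => rw [Function.iterate_succ_apply']; exact (hN _).trans ih
  -- choose n
  obtain ⟨L, hL⟩ : ∃ L : ℕ, ∀ A ∈ D, A.length ≤ L :=
    ⟨D.sup List.length, fun A hA => Finset.le_sup (f := List.length) hA⟩
  obtain ⟨n, hn⟩ := exists_nat_gt (max (L : ℝ) (2 * L * ‖x‖ / (ε / 2)))
  have hn1 : L < n := by exact_mod_cast (le_max_left _ _).trans_lt hn
  have hn2 : 2 * L * ‖x‖ / (ε / 2) < n := (le_max_right _ _).trans_lt hn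
  have hn0 : 0 < n := by omega
  have hnr : (0 : ℝ) < n := by exact_mod_cast hn0
  have hlim : ∀ A ∈ D, ∀ B ∈ D, ∀ᶠ W in atTop,
      ‖ent ((n : ℂ)⁻¹ • ∑ j ∈ Finset.Ico n (2 * n), Zop x cc n j W) A B - ent x A B‖ ≤ ε := by
    intro A hA B hB
    have hBn := hL B hB
    have hAn := hL A hA
    have h1 : Tendsto
        (fun W => ent ((n : ℂ)⁻¹ • ∑ j ∈ Finset.Ico n (2 * n), Zop x cc n j W) A B) atTop
        (𝓝 ((n : ℂ)⁻¹ * ∑ j ∈ Finset.Ico n (2 * n),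
          (if n ≤ A.length + (j - B.length) ∧ A.length + (j - B.length) < 2 * n
            then ent x A B else 0))) := by
      simp only [ent_smul, ent_sum]
      refine Tendsto.const_mul _ (tendsto_finsetSum _ fun j hj => ?_)
      simp only [Finset.mem_Ico] at hj
      exact (Z_main hω hs hQ hb hc hx (j - B.length) A B (by omega)).2
    have h2 := fejer_bound n A.length B.length hn0 (ent x A B) (by omega)
    have h3 : ((A.length : ℝ) + B.length) / n * ‖ent x A B‖ ≤ ε / 2 := by
      have hA' : (A.length : ℝ) ≤ L := by exact_mod_cast hAn
      have hB' : (B.length : ℝ) ≤ L := by exact_mod_cast hBn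
      calc _ ≤ ((L : ℝ) + L) / n * ‖x‖ := by
            gcongr
            exact norm_ent_le _ _ _
        _ = 2 * L * ‖x‖ / n := by ring
        _ ≤ ε / 2 := by
          rw [div_lt_iff₀ (by positivity)] at hn2
          rw [div_le_iff₀ hnr]; linarith
    filter_upwards [Metric.tendsto_nhds.1 h1 (ε / 2) (by positivity)] with W hW
    rw [dist_eq_norm] at hW
    have h4 := norm_add_le_of_le hW.le (h2.trans h3)
    rw [sub_add_sub_cancel] at h4
    linarith
  have hall : ∀ᶠ W in atTop, ∀ A ∈ D, ∀ B ∈ D,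
      ‖ent ((n : ℂ)⁻¹ • ∑ j ∈ Finset.Ico n (2 * n), Zop x cc n j W) A B - ent x A B‖ ≤ ε := by
    rw [Filter.eventually_all_finset]
    intro A hA
    rw [Filter.eventually_all_finset]
    exact hlim A hA
  obtain ⟨W, hW⟩ := hall.exists
  have hU : ∀ S ∈ W.filter (fun S => n ≤ S.length ∧ S.length < 2 * n),
      n ≤ S.length ∧ S.length < 2 * n := fun S hS => (Finset.mem_filter.1 hS).2
  set U := W.filter (fun S => n ≤ S.length ∧ S.length < 2 * n) with hUdef
  refine ⟨(n : ℂ)⁻¹ • ∑ q ∈ U ×ˢ U, ent x q.1 q.2 • cc q.1 q.2, ⟨n, U, rfl⟩, ?_, ?_⟩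
  · have h1 := (hNN (2 * n) _).trans (norm_X hR x U n hn0 hU)
    rw [map_smul, map_sum] at h1
    simp only [map_smul] at h1
    rwa [Finset.sum_congr rfl fun q hq => by
      rw [hcN q.1 q.2 (2 * n) (hU _ (Finset.mem_product.1 hq).2).2.le]] at h1
  · rw [Y_eq_sum_Z x cc n W U hUdef]
    exact hW

end Final

end FockAux

/-- For all words `I, J` the sequence `(P_ω^n (r_I (r_J)*))` converges in
SOT to a bounded operator `c I J` (the Choi–Effros product `r_I ∘ (r_J)*`), and every
harmonic bounded operator belongs to the closure, in the weak operator topology, of the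
linear span of the `c I J`.  (The Poisson boundary is the σ-weak closure of the Cuntz
algebra generated by the right creation operators.) -/
theorem statement12 {Θ : Type*} [Countable Θ] [Nonempty Θ] [DecidableEq Θ]
    (l r : Θ → Fock Θ →L[ℂ] Fock Θ)
    (hl : ∀ (i : Θ) (I : List Θ), l i (fockBasis I) = fockBasis (i :: I))
    (hr : ∀ (i : Θ) (I : List Θ), r i (fockBasis I) = fockBasis (I ++ [i]))
    (ω : Θ → ℝ) (hω : ∀ i, 0 < ω i) (hω1 : ∑' i, ω i = 1)
    (P : (Fock Θ →L[ℂ] Fock Θ) → (Fock Θ →L[ℂ] Fock Θ))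
    (hP : ∀ (x : Fock Θ →L[ℂ] Fock Θ) (v : Fock Θ),
      P x v = ∑' i, (ω i : ℂ) • ((ContinuousLinearMap.adjoint (l i) ∘L x ∘L l i) v)) :
    ∃ c : List Θ → List Θ → (Fock Θ →L[ℂ] Fock Θ),
      (∀ (I J : List Θ) (v : Fock Θ),
        Tendsto
          (fun n : ℕ =>
            (P^[n] (wordOp r I ∘L ContinuousLinearMap.adjoint (wordOp r J))) v)
          atTop (𝓝 (c I J v))) ∧
      (∀ x : Fock Θ →L[ℂ] Fock Θ, P x = x →
        ContinuousLinearMapWOT.ofCLM x ∈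
          closure (↑(Submodule.span ℂ
            {y : Fock Θ →WOT[ℂ] Fock Θ |
              ∃ I J : List Θ, y = ContinuousLinearMapWOT.ofCLM (c I J)}) :
                Set (Fock Θ →WOT[ℂ] Fock Θ))) := by
  have hln : ∀ i, ‖l i‖ ≤ 1 := fun i =>
    FockAux.norm_le_one_of (l i) (fun I => i :: I) (fun _ _ h => (List.cons.inj h).2) (hl i)
  have hs : HasSum ω 1 := by
    have : Summable ω := by
      by_contra h
      rw [tsum_eq_zero_of_not_summable h] at hω1
      exact zero_ne_one hω1
    rw [← hω1]; exact this.hasSum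
  have hN := FockAux.norm_P_le hln hω hs hP
  have hQ := FockAux.ent_P hln hω hs.summable hP hl
  obtain ⟨Q, rfl⟩ := FockAux.exists_linear hln hω hs.summable hP
  have hR : ∀ S K : List Θ, wordOp r S.reverse (fockBasis K) = fockBasis (K ++ S) := by
    intro S K
    rw [FockAux.wordOp_basis hr, List.reverse_reverse]
  refine ⟨fun I J => Q^[J.length]
    (wordOp r I ∘L ContinuousLinearMap.adjoint (wordOp r J)), ?_, ?_⟩
  · intro I J v
    refine tendsto_const_nhds.congr' ?_
    filter_upwards [eventually_ge_atTop J.length] with n hn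
    have := FockAux.iter_const (FockAux.wordOp_basis hr I) (FockAux.wordOp_basis hr J) hs hQ n
      (by simpa using hn)
    rw [this, List.length_reverse]
  · intro x hx
    refine FockAux.mem_closure_WOT x _ ‖x‖ fun D ε hε => ?_
    obtain ⟨y, ⟨n, U, rfl⟩, h1, h2⟩ := FockAux.main_approx (R := fun S => wordOp r S.reverse)
      hω hs hQ hN hR hx D ε hε
    refine ⟨_, ?_, h1, h2⟩
    let M := (Submodule.span ℂ
            {y : Fock Θ →WOT[ℂ] Fock Θ |
              ∃ I J : List Θ, y = ContinuousLinearMapWOT.ofCLM (Q^[J.length]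
    (wordOp r I ∘L ContinuousLinearMap.adjoint (wordOp r J)))}).comap
      (ContinuousLinearMap.WOTofCLM : (Fock Θ →L[ℂ] Fock Θ) →L[ℂ] (Fock Θ →WOT[ℂ] Fock Θ)).toLinearMap
    refine (show _ ∈ M from ?_)
    refine M.smul_mem _ (M.sum_mem fun q _ => M.smul_mem _ ?_)
    refine Submodule.subset_span ⟨q.1.reverse, q.2.reverse, ?_⟩
    rw [List.length_reverse]; rfl
end
end

section
/- For every word I : List Θ the sequence (P_ω^n(r_I (r_I)*)) converges in SOT to a bounded operator c_I, and c_I is both harmonic and diagonal. Moreover, every bounded operator x on F that is harmonic and diagonal belongs to the closure, in the weak operator topology, of the linear span of { c_I : I ∈ List Θ }. (This expresses that the diagonal part D_ω of the Poisson boundary is generated, as a von Neumann algebra, by the Choi–Effros products r_I ∘ r_I*.) -/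
open Filter Topology

noncomputable section

set_option linter.unusedSectionVars false

section Helpers

variable {Θ : Type*} [DecidableEq Θ]

/-- `x` is the diagonal operator with symbol `d`. -/
def IsDiagOp (x : Fock Θ →L[ℂ] Fock Θ) (d : List Θ → ℂ) : Prop :=
  ∀ (v : Fock Θ) (J : List Θ), (x v) J = d J * v J

lemma fockBasis_apply (I J : List Θ) : (fockBasis I : Fock Θ) J = if J = I then 1 else 0 := by
  unfold fockBasis
  rw [lp.single_apply]
  split_ifs with h
  · subst h; simp
  · simp [h]

lemma inner_fockBasis_left (J : List Θ) (v : Fock Θ) :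
    (inner ℂ (fockBasis J) v : ℂ) = v J := by
  unfold fockBasis
  rw [lp.inner_single_left]
  simp

lemma inner_fockBasis_right (J : List Θ) (v : Fock Θ) :
    (inner ℂ v (fockBasis J) : ℂ) = (starRingEnd ℂ) (v J) := by
  rw [← inner_conj_symm, inner_fockBasis_left]

lemma hasSum_fockBasis (v : Fock Θ) : HasSum (fun J => v J • fockBasis J) v := by
  have h := lp.hasSum_single (p := 2) (E := fun _ : List Θ => ℂ) (by simp) v
  have e : (fun J => v J • (fockBasis J : Fock Θ)) = fun J => lp.single 2 J (v J) := by
    funext J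
    unfold fockBasis
    rw [← lp.single_smul]
    simp
  rw [e]
  exact h

lemma clm_ext_basis {x y : Fock Θ →L[ℂ] Fock Θ} (h : ∀ J, x (fockBasis J) = y (fockBasis J)) :
    x = y := by
  ext1 v
  have h1 := (hasSum_fockBasis v).mapL x
  have h2 := (hasSum_fockBasis v).mapL y
  simp only [map_smul, h] at h1 h2
  exact h1.unique h2

lemma adjoint_apply_of_basis {x : Fock Θ →L[ℂ] Fock Θ} {g : List Θ → List Θ}
    (h : ∀ J, x (fockBasis J) = fockBasis (g J)) (u : Fock Θ) (J : List Θ) :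
    (ContinuousLinearMap.adjoint x u) J = u (g J) := by
  rw [← inner_fockBasis_left, ContinuousLinearMap.adjoint_inner_right, h, inner_fockBasis_left]

lemma isDiagOp_of_basis {x : Fock Θ →L[ℂ] Fock Θ} {d : List Θ → ℂ}
    (h : ∀ J, x (fockBasis J) = d J • fockBasis J) : IsDiagOp x d := by
  intro v K
  have h1 := ((hasSum_fockBasis v).mapL x).mapL (lp.evalCLM ℂ (fun _ : List Θ => ℂ) 2 K)
  have h2 : HasSum (fun J => if J = K then d K * v K else 0) (d K * v K) := hasSum_ite_eq K _
  refine h1.unique ?_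
  convert! h2 using 2 with J
  rw [map_smul, h]
  change v J * (d J * (fockBasis J : Fock Θ) K) = _
  rw [fockBasis_apply]
  by_cases hJ : J = K
  · subst hJ; simp [mul_comm]
  · simp [hJ, Ne.symm hJ]

lemma isDiagOp_of_inner {x : Fock Θ →L[ℂ] Fock Θ}
    (h : ∀ I' J' : List Θ, I' ≠ J' → (inner ℂ (x (fockBasis J')) (fockBasis I') : ℂ) = 0) :
    IsDiagOp x (fun J => (x (fockBasis J)) J) := by
  apply isDiagOp_of_basis
  intro J
  ext K
  change _ = (x (fockBasis J)) J * (fockBasis J : Fock Θ) K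
  rw [fockBasis_apply]
  by_cases hK : K = J
  · subst hK; simp
  · have := h K J hK
    rw [inner_fockBasis_right] at this
    simpa [hK] using this

lemma IsDiagOp.inner_eq_zero {x : Fock Θ →L[ℂ] Fock Θ} {d : List Θ → ℂ} (h : IsDiagOp x d)
    (I J : List Θ) (hIJ : I ≠ J) : (inner ℂ (x (fockBasis J)) (fockBasis I) : ℂ) = 0 := by
  rw [inner_fockBasis_right, h, fockBasis_apply, if_neg hIJ]
  simp

lemma IsDiagOp.unique {x y : Fock Θ →L[ℂ] Fock Θ} {d : List Θ → ℂ} (hx : IsDiagOp x d)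
    (hy : IsDiagOp y d) : x = y := by
  ext v J
  rw [hx, hy]

lemma IsDiagOp.norm_le {x : Fock Θ →L[ℂ] Fock Θ} {d : List Θ → ℂ} (hx : IsDiagOp x d)
    {C : ℝ} (hC : 0 ≤ C) (hd : ∀ J, ‖d J‖ ≤ C) (v : Fock Θ) : ‖x v‖ ≤ C * ‖v‖ := by
  have h : ‖x v‖ ≤ ‖(C : ℂ) • v‖ := by
    apply lp.norm_mono (by simp)
    intro J
    change _ ≤ ‖(C : ℂ) * v J‖
    rw [hx, norm_mul, norm_mul]
    gcongr
    simpa [abs_of_nonneg hC] using hd J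
  rwa [norm_smul, Complex.norm_real, Real.norm_eq_abs, abs_of_nonneg hC] at h

lemma IsDiagOp.symbol_norm_le {x : Fock Θ →L[ℂ] Fock Θ} {d : List Θ → ℂ} (hx : IsDiagOp x d)
    (J : List Θ) : ‖d J‖ ≤ ‖x‖ := by
  have h1 : (x (fockBasis J)) J = d J := by
    rw [hx, fockBasis_apply]; simp
  rw [← h1]
  refine (lp.norm_apply_le_norm (by simp) _ J).trans ((x.le_opNorm _).trans ?_)
  have : ‖(fockBasis J : Fock Θ)‖ = 1 := by
    unfold fockBasis
    rw [lp.norm_single (by simp)]; simp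
  rw [this, mul_one]

lemma IsDiagOp.smul {x : Fock Θ →L[ℂ] Fock Θ} {d : List Θ → ℂ} (hx : IsDiagOp x d) (a : ℂ) :
    IsDiagOp (a • x) (fun J => a * d J) := by
  intro v J
  change a * (x v) J = _
  rw [hx]; ring

lemma IsDiagOp.sum {ι : Type*} {s : Finset ι} {x : ι → Fock Θ →L[ℂ] Fock Θ}
    {d : ι → List Θ → ℂ} (hx : ∀ i ∈ s, IsDiagOp (x i) (d i)) :
    IsDiagOp (∑ i ∈ s, x i) (fun J => ∑ i ∈ s, d i J) := by
  intro v J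
  rw [sum_apply, lp.coeFn_sum, Finset.sum_apply, Finset.sum_mul]
  exact Finset.sum_congr rfl fun i hi => hx i hi v J

section Creation
variable {l : Θ → Fock Θ →L[ℂ] Fock Θ}


lemma adj_comp_creation
    (hl : ∀ (i : Θ) (I : List Θ), l i (fockBasis I) = fockBasis (i :: I))
    (i : Θ) : ContinuousLinearMap.adjoint (l i) ∘L l i = 1 := by
  apply clm_ext_basis
  intro J
  ext K
  change (ContinuousLinearMap.adjoint (l i) (l i (fockBasis J))) K = (fockBasis J : Fock Θ) K
  rw [adjoint_apply_of_basis (hl i), hl, fockBasis_apply, fockBasis_apply]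
  simp


lemma creation_apply_cons
    (hl : ∀ (i : Θ) (I : List Θ), l i (fockBasis I) = fockBasis (i :: I))
    (i : Θ) (v : Fock Θ) (J : List Θ) : (l i v) (i :: J) = v J := by
  rw [← adjoint_apply_of_basis (hl i)]
  have := congrArg (fun T => (T v) J) (adj_comp_creation hl i)
  exact this


lemma creation_norm
    (hl : ∀ (i : Θ) (I : List Θ), l i (fockBasis I) = fockBasis (i :: I))
    (i : Θ) (v : Fock Θ) : ‖l i v‖ = ‖v‖ := by
  have h : (inner ℂ (l i v) (l i v) : ℂ) = inner ℂ v v := by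
    rw [← ContinuousLinearMap.adjoint_inner_right]
    have := congrArg (fun T => T v) (adj_comp_creation hl i)
    change ContinuousLinearMap.adjoint (l i) (l i v) = v at this
    rw [this]
  rw [inner_self_eq_norm_sq_to_K, inner_self_eq_norm_sq_to_K] at h
  norm_cast at h
  exact (sq_eq_sq₀ (norm_nonneg _) (norm_nonneg _)).mp (by exact_mod_cast h)


lemma creation_adj_norm_le
    (hl : ∀ (i : Θ) (I : List Θ), l i (fockBasis I) = fockBasis (i :: I))
    (i : Θ) (v : Fock Θ) : ‖ContinuousLinearMap.adjoint (l i) v‖ ≤ ‖v‖ := by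
  have h1 : ‖l i‖ ≤ 1 := ContinuousLinearMap.opNorm_le_bound _ zero_le_one
    (fun v => by rw [creation_norm hl, one_mul])
  have h2 : ‖ContinuousLinearMap.adjoint (l i)‖ ≤ 1 := by
    rw [LinearIsometryEquiv.norm_map]; exact h1
  calc _ ≤ ‖ContinuousLinearMap.adjoint (l i)‖ * ‖v‖ := ContinuousLinearMap.le_opNorm _ _
    _ ≤ 1 * ‖v‖ := by gcongr
    _ = ‖v‖ := one_mul _


lemma isDiagOp_markov
    (hl : ∀ (i : Θ) (I : List Θ), l i (fockBasis I) = fockBasis (i :: I))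
    {ω : Θ → ℝ} (hω : ∀ i, 0 < ω i) (hs : Summable ω)
    {P : (Fock Θ →L[ℂ] Fock Θ) → (Fock Θ →L[ℂ] Fock Θ)}
    (hP : ∀ (x : Fock Θ →L[ℂ] Fock Θ) (v : Fock Θ),
      P x v = ∑' i, (ω i : ℂ) • ((ContinuousLinearMap.adjoint (l i) ∘L x ∘L l i) v))
    {x : Fock Θ →L[ℂ] Fock Θ} {d : List Θ → ℂ} (hx : IsDiagOp x d) :
    IsDiagOp (P x) (fun J => ∑' i, (ω i : ℂ) * d (i :: J)) := by
  intro v J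
  have hsum : Summable
      (fun i => (ω i : ℂ) • ((ContinuousLinearMap.adjoint (l i) ∘L x ∘L l i) v)) := by
    refine Summable.of_norm_bounded (g := fun i => ω i * (‖x‖ * ‖v‖)) (hs.mul_right _) ?_
    intro i
    rw [norm_smul, Complex.norm_real, Real.norm_eq_abs, abs_of_pos (hω i)]
    have := (hω i).le
    gcongr
    refine (creation_adj_norm_le hl i _).trans ((x.le_opNorm _).trans ?_)
    exact le_of_eq (congrArg (fun t => ‖x‖ * t) (creation_norm hl i v))
  have h1 := hsum.hasSum.mapL (lp.evalCLM ℂ (fun _ : List Θ => ℂ) 2 J)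
  rw [← hP] at h1
  change HasSum _ ((P x v) J) at h1
  rw [← h1.tsum_eq, ← tsum_mul_right]
  congr 1
  ext i
  rw [map_smul]
  change (ω i : ℂ) * (ContinuousLinearMap.adjoint (l i) (x (l i v))) J = _
  rw [adjoint_apply_of_basis (hl i), hx, creation_apply_cons hl]
  ring

end Creation

lemma wordOp_basis {r : Θ → Fock Θ →L[ℂ] Fock Θ}
    (hr : ∀ (i : Θ) (I : List Θ), r i (fockBasis I) = fockBasis (I ++ [i])) (I J : List Θ) :
    wordOp r I (fockBasis J) = fockBasis (J ++ I.reverse) := by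
  induction I with
  | nil => simp [wordOp]
  | cons i I ih =>
    change r i (wordOp r I (fockBasis J)) = _
    rw [ih, hr]; simp

/-- The symbol of `r_I r_I*`, with `W` the reverse of `I`. -/
def sufInd (W J : List Θ) : ℝ := if W <:+ J then 1 else 0

lemma isDiagOp_wordOp {r : Θ → Fock Θ →L[ℂ] Fock Θ}
    (hr : ∀ (i : Θ) (I : List Θ), r i (fockBasis I) = fockBasis (I ++ [i])) (I : List Θ) :
    IsDiagOp (wordOp r I ∘L ContinuousLinearMap.adjoint (wordOp r I))
      (fun J => (sufInd I.reverse J : ℂ)) := by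
  apply isDiagOp_of_basis
  intro K
  change wordOp r I (ContinuousLinearMap.adjoint (wordOp r I) (fockBasis K)) = _
  unfold sufInd
  split_ifs with h
  · obtain ⟨J, rfl⟩ := h
    have : ContinuousLinearMap.adjoint (wordOp r I) (fockBasis (J ++ I.reverse)) = fockBasis J := by
      ext M
      rw [adjoint_apply_of_basis (wordOp_basis hr I), fockBasis_apply, fockBasis_apply]
      simp
    rw [this, wordOp_basis hr]; simp
  · have : ContinuousLinearMap.adjoint (wordOp r I) (fockBasis K) = 0 := by
      ext M
      rw [adjoint_apply_of_basis (wordOp_basis hr I), fockBasis_apply, if_neg]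
      · rfl
      · rintro rfl; exact h ⟨M, rfl⟩
    rw [this]; simp


/-- The Markov operator on real symbols. -/
def symD (ω : Θ → ℝ) (g : List Θ → ℝ) (J : List Θ) : ℝ := ∑' i, ω i * g (i :: J)

/-- The symbol of `c_I`, with `W` the reverse of `I`. -/
def symC (ω : Θ → ℝ) (W : List Θ) : List Θ → ℝ := (symD ω)^[W.length] (sufInd W)

lemma sufInd_cons (W J : List Θ) (i : Θ) (h : W.length ≤ J.length) :
    sufInd W (i :: J) = sufInd W J := by
  unfold sufInd
  congr 1
  rw [List.suffix_cons_iff]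
  apply propext
  constructor
  · rintro (rfl | hsuf)
    · simp at h
    · exact hsuf
  · exact Or.inr

lemma symD_stab {ω : Θ → ℝ} (hω1 : ∑' i, ω i = 1) (W : List Θ) (n : ℕ) :
    ∀ J : List Θ, W.length ≤ J.length + n →
      (symD ω)^[n + 1] (sufInd W) J = (symD ω)^[n] (sufInd W) J := by
  induction n with
  | zero =>
    intro J hJ
    change ∑' i, ω i * sufInd W (i :: J) = sufInd W J
    simp_rw [sufInd_cons W J _ hJ]
    rw [tsum_mul_right, hω1, one_mul]
  | succ n ih =>
    intro J hJ
    rw [Function.iterate_succ_apply' _ (n + 1), Function.iterate_succ_apply' _ n]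
    have h1 : ∀ i, symD ω ((symD ω)^[n] (sufInd W)) (i :: J) =
        (symD ω)^[n] (sufInd W) (i :: J) := by
      intro i
      have := ih (i :: J) (by simp; omega)
      rwa [Function.iterate_succ_apply'] at this
    exact tsum_congr fun i => congrArg (fun t => ω i * t) (h1 i)

lemma symD_symC {ω : Θ → ℝ} (hω1 : ∑' i, ω i = 1) (W : List Θ) :
    symD ω (symC ω W) = symC ω W := by
  ext J
  have := symD_stab hω1 W W.length J (by omega)
  rwa [Function.iterate_succ_apply'] at this

lemma symC_of_length_le {ω : Θ → ℝ} (hω1 : ∑' i, ω i = 1) (W J : List Θ)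
    (h : W.length ≤ J.length) : symC ω W J = sufInd W J := by
  have key : ∀ k : ℕ, (symD ω)^[k] (sufInd W) J = sufInd W J := by
    intro k
    induction k with
    | zero => rfl
    | succ k ih => rw [symD_stab hω1 W k J (by omega), ih]
  exact key _

lemma symC_nonneg {ω : Θ → ℝ} (hω : ∀ i, 0 < ω i) (W J : List Θ) : 0 ≤ symC ω W J := by
  unfold symC
  generalize W.length = k
  induction k generalizing J with
  | zero => simp only [Function.iterate_zero, id]; unfold sufInd; split_ifs <;> simp
  | succ k ih =>
    rw [Function.iterate_succ_apply']
    exact tsum_nonneg fun i => mul_nonneg (hω i).le (ih _)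

/-- Exchange of summation. -/
lemma hasSum_step {ω : Θ → ℝ} (hω : ∀ i, 0 < ω i) (hs : Summable ω) {A : Θ → List Θ → ℝ}
    (hA0 : ∀ i W, 0 ≤ A i W) (hA1 : ∀ i, HasSum (A i) 1) {f : List Θ → ℂ} {C : ℝ}
    (hf : ∀ W, ‖f W‖ ≤ C) {t : Θ → ℂ} (ht : ∀ i, HasSum (fun W => f W * (A i W : ℂ)) (t i)) :
    HasSum (fun W => f W * ((∑' i, ω i * A i W : ℝ) : ℂ)) (∑' i, (ω i : ℂ) * t i) := by
  have hsum1 : Summable (fun p : Θ × List Θ => ω p.1 * A p.1 p.2) := by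
    have h0 : 0 ≤ (fun p : Θ × List Θ => ω p.1 * A p.1 p.2) :=
      fun p => mul_nonneg (hω p.1).le (hA0 p.1 p.2)
    have hfib : ∀ i, HasSum (fun W => ω i * A i W) (ω i * 1) := fun i => (hA1 i).mul_left (ω i)
    refine (summable_prod_of_nonneg h0).mpr ⟨fun i => (hfib i).summable, ?_⟩
    have e : (fun i => ∑' W, ω i * A i W) = ω := by
      funext i
      rw [(hfib i).tsum_eq, mul_one]
    change Summable (fun i => ∑' W, ω i * A i W)
    rw [e]
    exact hs
  have hsum : Summable (fun p : Θ × List Θ => (ω p.1 : ℂ) * (f p.2 * (A p.1 p.2 : ℂ))) := by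
    refine Summable.of_norm_bounded (hsum1.mul_left C) ?_
    rintro ⟨i, W⟩
    simp only [norm_mul, Complex.norm_real, Real.norm_eq_abs, abs_of_pos (hω i),
      abs_of_nonneg (hA0 i W)]
    have := mul_le_mul_of_nonneg_right (hf W) (mul_nonneg (hω i).le (hA0 i W))
    linarith
  have h1 := hsum.hasSum.prod_fiberwise (fun i => (ht i).mul_left (ω i : ℂ))
  have hsw : HasSum (fun p : List Θ × Θ => (ω p.2 : ℂ) * (f p.1 * (A p.2 p.1 : ℂ)))
      (∑' i, (ω i : ℂ) * t i) := by
    rw [h1.tsum_eq]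
    exact (Equiv.prodComm (List Θ) Θ).hasSum_iff.mpr hsum.hasSum
  refine hsw.prod_fiberwise (fun W => ?_)
  have hW : Summable (fun i => ω i * A i W) :=
    hsum1.comp_injective (i := fun i => (i, W)) (fun a b hab => by simpa using hab)
  have h3 := (Complex.hasSum_ofReal.mpr hW.hasSum).mul_left (f W)
  convert! h3 using 2 with i
  push_cast
  ring

/-- `symC` restricted to words of length `n`. -/
def symCn (ω : Θ → ℝ) (n : ℕ) (J W : List Θ) : ℝ := if W.length = n then symC ω W J else 0

lemma symCn_step {ω : Θ → ℝ} (hω1 : ∑' i, ω i = 1) (n : ℕ) (J W : List Θ) :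
    symCn ω n J W = ∑' i, ω i * symCn ω n (i :: J) W := by
  unfold symCn
  split_ifs with h
  · exact (congrFun (symD_symC hω1 W) J).symm
  · simp

lemma symCn_nonneg {ω : Θ → ℝ} (hω : ∀ i, 0 < ω i) (n : ℕ) (J W : List Θ) :
    0 ≤ symCn ω n J W := by
  unfold symCn
  split_ifs
  · exact symC_nonneg hω W J
  · rfl

lemma symCn_of_le {ω : Θ → ℝ} (hω1 : ∑' i, ω i = 1) (n : ℕ) (J : List Θ) (hJ : n ≤ J.length)
    (W : List Θ) : symCn ω n J W = if W = J.drop (J.length - n) then 1 else 0 := by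
  unfold symCn
  by_cases h : W.length = n
  · rw [if_pos h, symC_of_length_le hω1 _ _ (by omega)]
    unfold sufInd
    simp only [List.suffix_iff_eq_drop, h]
  · rw [if_neg h, if_neg]
    rintro rfl
    simp at h
    omega

lemma hasSum_symCn {ω : Θ → ℝ} (hω : ∀ i, 0 < ω i) (hs : Summable ω) (hω1 : ∑' i, ω i = 1)
    (n m : ℕ) : ∀ J : List Θ, n ≤ J.length + m → HasSum (symCn ω n J) 1 := by
  induction m with
  | zero =>
    intro J hJ
    have : symCn ω n J = fun W => if W = J.drop (J.length - n) then 1 else 0 :=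
      funext (symCn_of_le hω1 n J hJ)
    rw [this]
    exact hasSum_ite_eq _ _
  | succ m ih =>
    intro J hJ
    have hi : ∀ i, HasSum (symCn ω n (i :: J)) 1 := fun i => ih (i :: J) (by simp; omega)
    have := hasSum_step hω hs (A := fun i => symCn ω n (i :: J))
      (fun i W => symCn_nonneg hω n _ W) hi (f := fun _ => 1) (C := 1) (by simp)
      (t := fun _ => 1) (fun i => by simpa using Complex.hasSum_ofReal.mpr (hi i))
    simp_rw [← symCn_step hω1, mul_one, one_mul, ← Complex.ofReal_tsum, hω1] at this
    exact Complex.hasSum_ofReal.mp this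

lemma hasSum_symCn_mul {ω : Θ → ℝ} (hω : ∀ i, 0 < ω i) (hs : Summable ω) (hω1 : ∑' i, ω i = 1)
    {f : List Θ → ℂ} {C : ℝ} (hf : ∀ W, ‖f W‖ ≤ C) (hfD : ∀ J, ∑' i, (ω i : ℂ) * f (i :: J) = f J)
    (n m : ℕ) : ∀ J : List Θ, n = J.length + m →
      HasSum (fun W => f W * (symCn ω n J W : ℂ)) (f J) := by
  induction m with
  | zero =>
    intro J hJ
    have : (fun W => f W * (symCn ω n J W : ℂ)) = fun W => if W = J then f J else 0 := by
      funext W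
      rw [symCn_of_le hω1 n J (by omega)]
      have : J.length - n = 0 := by omega
      rw [this, List.drop_zero]
      split_ifs with h
      · simp [h]
      · simp
    rw [this]
    exact hasSum_ite_eq _ _
  | succ m ih =>
    intro J hJ
    have := hasSum_step hω hs (A := fun i => symCn ω n (i :: J))
      (fun i W => symCn_nonneg hω n _ W)
      (fun i => hasSum_symCn hω hs hω1 n n (i :: J) (by omega)) hf
      (t := fun i => f (i :: J)) (fun i => ih (i :: J) (by simp; omega))
    simp_rw [← symCn_step hω1, hfD] at this
    exact this

/-- Bounded approximation on basis vectors gives membership in the WOT closure. -/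
lemma mem_wot_closure {S : Set (Fock Θ →WOT[ℂ] Fock Θ)} {x : Fock Θ →L[ℂ] Fock Θ} {C : ℝ}
    (hC : 0 ≤ C) (h : ∀ (s : Finset (List Θ)) (ε : ℝ), 0 < ε → ∃ y : Fock Θ →L[ℂ] Fock Θ,
      ContinuousLinearMapWOT.ofCLM y ∈ S ∧ (∀ v, ‖y v‖ ≤ C * ‖v‖) ∧
      ∀ J ∈ s, ‖y (fockBasis J) - x (fockBasis J)‖ ≤ ε) :
    ContinuousLinearMapWOT.ofCLM x ∈ closure S := by
  choose y hyS hyC hy using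
    fun p : Finset (List Θ) × ℕ => h p.1 (1 / ((p.2 : ℝ) + 1)) (by positivity)
  have hbasis : ∀ J, Tendsto (fun p => y p (fockBasis J)) atTop (𝓝 (x (fockBasis J))) := by
    intro J
    rw [tendsto_iff_norm_sub_tendsto_zero]
    have h0 : Tendsto (fun p : Finset (List Θ) × ℕ => 1 / ((p.2 : ℝ) + 1)) atTop (𝓝 0) := by
      rw [← prod_atTop_atTop_eq]
      exact tendsto_one_div_add_atTop_nhds_zero_nat.comp tendsto_snd
    refine squeeze_zero' (Eventually.of_forall fun _ => norm_nonneg _) ?_ h0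
    filter_upwards [eventually_ge_atTop (({J} : Finset (List Θ)), 0)] with p hp
    exact hy p J (hp.1 (by simp))
  have hall : ∀ v, Tendsto (fun p => y p v) atTop (𝓝 (x v)) := by
    intro v
    rw [Metric.tendsto_nhds]
    intro ε hε
    have hK : 0 < C + ‖x‖ + 1 := by positivity
    have h1 := (Metric.tendsto_nhds.mp (hasSum_fockBasis v)) (ε / 2 / (C + ‖x‖ + 1)) (by positivity)
    obtain ⟨s, hs⟩ := h1.exists
    set u : Fock Θ := ∑ J ∈ s, v J • fockBasis J with hu
    have hyu : Tendsto (fun p => y p u) atTop (𝓝 (x u)) := by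
      simp only [hu, map_sum, map_smul]
      exact tendsto_finsetSum _ fun J _ => (hbasis J).const_smul _
    filter_upwards [(Metric.tendsto_nhds.mp hyu) (ε / 2) (by positivity)] with p hp
    rw [dist_eq_norm] at hs hp ⊢
    have e : y p v - x v = (y p u - x u) - (y p (u - v) - x (u - v)) := by
      simp only [map_sub]; abel
    have h2 := hyC p (u - v)
    have h3 := x.le_opNorm (u - v)
    have h4 : (C + ‖x‖ + 1) * ‖u - v‖ < ε / 2 := by
      rw [lt_div_iff₀ hK] at hs; linarith
    have h5 := norm_nonneg (u - v)
    rw [e]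
    have h6 := norm_sub_le (y p u - x u) (y p (u - v) - x (u - v))
    have h7 := norm_sub_le (y p (u - v)) (x (u - v))
    nlinarith
  refine mem_closure_of_tendsto (f := fun p => ContinuousLinearMapWOT.ofCLM (y p)) (b := atTop) ?_
    (Eventually.of_forall hyS)
  rw [ContinuousLinearMapWOT.tendsto_iff_forall_inner_apply_tendsto]
  intro v w
  exact Tendsto.inner tendsto_const_nhds (hall v)

end Helpers

/-- For every word `I` the sequence `(P_ω^n (r_I (r_I)*))` converges in SOT
to a bounded operator `c I`, which is harmonic and diagonal; and every harmonic diagonal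
bounded operator belongs to the WOT closure of the linear span of the `c I`.  (The diagonal
part `D_ω` of the Poisson boundary is generated by the Choi–Effros products `r_I ∘ r_I*`.) -/
theorem statement13 {Θ : Type*} [Countable Θ] [Nonempty Θ] [DecidableEq Θ]
    (l r : Θ → Fock Θ →L[ℂ] Fock Θ)
    (hl : ∀ (i : Θ) (I : List Θ), l i (fockBasis I) = fockBasis (i :: I))
    (hr : ∀ (i : Θ) (I : List Θ), r i (fockBasis I) = fockBasis (I ++ [i]))
    (ω : Θ → ℝ) (hω : ∀ i, 0 < ω i) (hω1 : ∑' i, ω i = 1)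
    (P : (Fock Θ →L[ℂ] Fock Θ) → (Fock Θ →L[ℂ] Fock Θ))
    (hP : ∀ (x : Fock Θ →L[ℂ] Fock Θ) (v : Fock Θ),
      P x v = ∑' i, (ω i : ℂ) • ((ContinuousLinearMap.adjoint (l i) ∘L x ∘L l i) v)) :
    ∃ c : List Θ → (Fock Θ →L[ℂ] Fock Θ),
      (∀ (I : List Θ) (v : Fock Θ),
        Tendsto
          (fun n : ℕ =>
            (P^[n] (wordOp r I ∘L ContinuousLinearMap.adjoint (wordOp r I))) v)
          atTop (𝓝 (c I v))) ∧
      (∀ I : List Θ, P (c I) = c I) ∧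
      (∀ I : List Θ, ∀ I' J' : List Θ, I' ≠ J' →
        (inner ℂ (c I (fockBasis J')) (fockBasis I') : ℂ) = 0) ∧
      (∀ x : Fock Θ →L[ℂ] Fock Θ, P x = x →
        (∀ I' J' : List Θ, I' ≠ J' → (inner ℂ (x (fockBasis J')) (fockBasis I') : ℂ) = 0) →
        ContinuousLinearMapWOT.ofCLM x ∈
          closure (↑(Submodule.span ℂ
            {y : Fock Θ →WOT[ℂ] Fock Θ |
              ∃ I : List Θ, y = ContinuousLinearMapWOT.ofCLM (c I)}) :
                Set (Fock Θ →WOT[ℂ] Fock Θ))) := by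
  have hs : Summable ω := by
    by_contra hns
    rw [tsum_eq_zero_of_not_summable hns] at hω1
    exact zero_ne_one hω1
  -- iterates of `P`
  have hiter : ∀ (I : List Θ) (n : ℕ),
      IsDiagOp (P^[n] (wordOp r I ∘L ContinuousLinearMap.adjoint (wordOp r I)))
        (fun J => (((symD ω)^[n] (sufInd I.reverse) J : ℝ) : ℂ)) := by
    intro I n
    induction n with
    | zero => exact isDiagOp_wordOp hr I
    | succ n ih =>
      rw [Function.iterate_succ_apply']
      have h1 := isDiagOp_markov hl hω hs hP ih
      convert! h1 using 2 with J
      rw [Function.iterate_succ_apply']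
      unfold symD
      push_cast
      rfl
  obtain ⟨c, hc⟩ : ∃ c : List Θ → (Fock Θ →L[ℂ] Fock Θ), ∀ I, c I =
      P^[I.length] (wordOp r I ∘L ContinuousLinearMap.adjoint (wordOp r I)) := ⟨_, fun _ => rfl⟩
  have hcd : ∀ I, IsDiagOp (c I) (fun J => (symC ω I.reverse J : ℂ)) := by
    intro I
    rw [hc]
    have := hiter I I.length
    unfold symC
    rwa [List.length_reverse]
  have hharm : ∀ I, P (c I) = c I := by
    intro I
    refine IsDiagOp.unique ?_ (hcd I)
    convert! isDiagOp_markov hl hω hs hP (hcd I) using 2 with J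
    conv_lhs => rw [← symD_symC hω1 I.reverse]
    unfold symD
    push_cast
    rfl
  refine ⟨c, ?_, hharm, fun I K L h => (hcd I).inner_eq_zero K L h, ?_⟩
  · intro I v
    refine tendsto_const_nhds.congr' ?_
    filter_upwards [eventually_ge_atTop I.length] with n hn
    obtain ⟨k, rfl⟩ := Nat.exists_eq_add_of_le hn
    rw [add_comm, Function.iterate_add_apply, ← hc, Function.iterate_fixed (hharm I)]
  · intro x hx hdiag
    have hxd := isDiagOp_of_inner hdiag
    set f : List Θ → ℂ := fun J => (x (fockBasis J)) J with hfdef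
    have hf : ∀ W, ‖f W‖ ≤ ‖x‖ := hxd.symbol_norm_le
    have hfD : ∀ J, ∑' i, (ω i : ℂ) * f (i :: J) = f J := by
      intro J
      have h1 := isDiagOp_markov hl hω hs hP hxd (fockBasis J) J
      rw [hx, fockBasis_apply, if_pos rfl, mul_one] at h1
      exact h1.symm
    refine mem_wot_closure (norm_nonneg x) ?_
    intro s ε hε
    set n := s.sup List.length with hn
    have hev : ∀ᶠ F : Finset (List Θ) in atTop, ∀ J ∈ s,
        dist (∑ W ∈ F, f W * (symCn ω n J W : ℂ)) (f J) < ε := by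
      rw [eventually_all_finset]
      intro J hJ
      have hle : J.length ≤ n := Finset.le_sup (f := List.length) hJ
      exact Metric.tendsto_nhds.mp
        (hasSum_symCn_mul hω hs hω1 hf hfD n (n - J.length) J (by omega)) ε hε
    obtain ⟨F, hF⟩ := hev.exists
    let a : List Θ → ℂ := fun W => if W.length = n then f W else 0
    have hy : IsDiagOp (∑ W ∈ F, a W • c W.reverse)
        (fun J => ∑ W ∈ F, f W * (symCn ω n J W : ℂ)) := by
      have h0 := IsDiagOp.sum (s := F) (fun W _ => (hcd W.reverse).smul (a W))
      have e : (fun J => ∑ W ∈ F, f W * (symCn ω n J W : ℂ)) =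
          fun J => ∑ W ∈ F, a W * (symC ω W.reverse.reverse J : ℂ) := by
        funext J
        refine Finset.sum_congr rfl fun W _ => ?_
        simp only [a, symCn, List.reverse_reverse]
        split_ifs <;> simp
      rw [e]
      exact h0
    refine ⟨∑ W ∈ F, a W • c W.reverse, ?_, hy.norm_le (norm_nonneg x) ?_, ?_⟩
    · have e : ContinuousLinearMapWOT.ofCLM (∑ W ∈ F, a W • c W.reverse) =
          ∑ W ∈ F, a W • ContinuousLinearMapWOT.ofCLM (c W.reverse) := by
        have := map_sum (ContinuousLinearMapWOT.linearEquiv (σ := RingHom.id ℂ) (E := Fock Θ)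
          (F := Fock Θ) ℂ).symm (fun W => a W • c W.reverse) F
        exact this
      rw [e]
      exact Submodule.sum_mem _ fun W _ => Submodule.smul_mem _ _
        (Submodule.subset_span ⟨W.reverse, rfl⟩)
    · intro J
      have h1 : HasSum (symCn ω n J) 1 := hasSum_symCn hω hs hω1 n n J (by omega)
      calc ‖∑ W ∈ F, f W * (symCn ω n J W : ℂ)‖
          ≤ ∑ W ∈ F, ‖x‖ * symCn ω n J W := by
            refine norm_sum_le_of_le _ fun W _ => ?_
            rw [norm_mul, Complex.norm_real, Real.norm_eq_abs,
              abs_of_nonneg (symCn_nonneg hω n J W)]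
            exact mul_le_mul_of_nonneg_right (hf W) (symCn_nonneg hω n J W)
        _ = ‖x‖ * ∑ W ∈ F, symCn ω n J W := by rw [Finset.mul_sum]
        _ ≤ ‖x‖ * 1 := by
            gcongr
            exact sum_le_hasSum F (fun W _ => symCn_nonneg hω n J W) h1
        _ = ‖x‖ := mul_one _
    · intro J hJ
      have hsub : IsDiagOp ((∑ W ∈ F, a W • c W.reverse) - x)
          (fun K => (∑ W ∈ F, f W * (symCn ω n K W : ℂ)) - f K) := by
        intro v K
        have h1 := hy v K
        have h2 := hxd v K
        change ((∑ W ∈ F, a W • c W.reverse) v) K - (x v) K = _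
        rw [h1, h2]; ring
      have e : (∑ W ∈ F, a W • c W.reverse) (fockBasis J) - x (fockBasis J) =
          ((∑ W ∈ F, f W * (symCn ω n J W : ℂ)) - f J) • fockBasis J := by
        ext K
        have h1 := hsub (fockBasis J) K
        change (((∑ W ∈ F, a W • c W.reverse) - x) (fockBasis J)) K =
          ((∑ W ∈ F, f W * (symCn ω n J W : ℂ)) - f J) * (fockBasis J : Fock Θ) K
        rw [h1, fockBasis_apply]
        by_cases hK : K = J
        · subst hK; rfl
        · simp [hK]
      have h1 : ‖(fockBasis J : Fock Θ)‖ = 1 := by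
        unfold fockBasis
        rw [lp.norm_single (by simp)]; simp
      rw [e, norm_smul, h1, mul_one, ← dist_eq_norm]
      exact (hF J hJ).le
end
end
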